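/- For every 0 < p < 1 and every c < 𝔠_p there exist a complete filtered probability space and a martingale X = (X_t)_{t≥0} with continuous sample paths and X_0 = 0 almost surely such that 0 < sup_{t≥0} (E[(−M⁻_t)^p])^{1/p} < ∞ and sup_{t≥0} (E[(M_t)^p])^{1/p} > c · sup_{t≥0} (E[(−M⁻_t)^p])^{1/p}. Here 𝔠_p^p = (1/p − 1)^p + ∫_{1/p−1}^∞ s^{p−1}/(s+1) ds if 0 < p ≤ 1/2 and 𝔠_p^p = 1 + ∫_1^∞ s^{p−1}/(s+1) ds if 1/2 < p < 1; M_t(ω) = sup_{0≤s≤t} |X_s(ω)| and M⁻_t(ω) = inf_{0≤s≤t} min(X_s(ω),0). -/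

import Mathlib

open MeasureTheory Filter Set
open scoped NNReal

section Construction

open ProbabilityTheory Topology
open scoped ENNReal

theorem exists_isonormal (H : Type) [NormedAddCommGroup H] [InnerProductSpace ℝ H]
    [CompleteSpace H] :
    ∃ (Ω : Type) (_ : MeasurableSpace Ω) (P : Measure Ω) (_ : IsProbabilityMeasure P)
      (W : H →ₗᵢ[ℝ] Lp ℝ 2 P), ∀ h, HasGaussianLaw (W h) P ∧ ∫ ω, W h ω ∂P = 0 := by
  obtain ⟨w, b, -⟩ := exists_hilbertBasis ℝ H
  obtain ⟨Ω, m, P, g, hgm, hgl, hgi, hP⟩ := exists_iid w (gaussianReal 0 1)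
  have hg2 : ∀ i, MemLp (g i) 2 P := fun i => (hgl i).hasGaussianLaw.memLp_two
  have hgint : ∀ i, ∫ ω, g i ω ∂P = 0 := fun i => by
    rw [(hgl i).integral_eq, integral_id_gaussianReal]
  have hgvar : ∀ i, ∫ ω, g i ω * g i ω ∂P = 1 := fun i => by
    have h1 := (hgl i).variance_eq
    rw [variance_id_gaussianReal, variance_eq_sub (hg2 i), hgint i] at h1
    simpa [pow_two] using h1
  have hon : Orthonormal ℝ (fun i => (hg2 i).toLp (g i)) := by
    classical
    rw [orthonormal_iff_ite]
    intro i j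
    rw [L2.inner_def]
    have : ∫ ω, inner ℝ ((hg2 i).toLp (g i) ω) ((hg2 j).toLp (g j) ω) ∂P
        = ∫ ω, g i ω * g j ω ∂P := by
      refine integral_congr_ae ?_
      filter_upwards [(hg2 i).coeFn_toLp, (hg2 j).coeFn_toLp] with ω h1 h2
      rw [h1, h2]; simp [mul_comm]
    rw [this]
    split_ifs with h
    · subst h; exact hgvar i
    · have := (hgi.indepFun h).integral_mul_eq_mul_integral
        (hgm i).aestronglyMeasurable (hgm j).aestronglyMeasurable
      simp only [hgint, mul_zero] at this
      simpa using this
  let W : H →ₗᵢ[ℝ] Lp ℝ 2 P :=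
    hon.orthogonalFamily.linearIsometry.comp b.repr.toLinearIsometry
  have hWb : ∀ i, W (b i) = (hg2 i).toLp (g i) := by
    classical
    intro i
    change hon.orthogonalFamily.linearIsometry (b.repr (b i)) = _
    rw [b.repr_self, OrthogonalFamily.linearIsometry_apply_single]
    simp
  refine ⟨Ω, m, P, hP, W, ?_⟩
  have hint0 : ∀ h, ∫ ω, W h ω ∂P = inner ℝ (Lp.const 2 P (1 : ℝ)) (W h) := by
    intro h
    rw [L2.inner_def]
    refine integral_congr_ae ?_
    filter_upwards [Lp.coeFn_const (p := 2) (μ := P) (1 : ℝ)] with ω h1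
    rw [h1]; simp
  have hcl : IsClosed {h : H | ∀ u : ℝ, charFun (P.map (W h)) u =
      Complex.exp (-(u ^ 2 * ‖h‖ ^ 2 / 2 : ℝ))} := by
    rw [ofPred_forall]
    refine isClosed_iInter fun u => isClosed_eq ?_ (by fun_prop)
    have hcf : ∀ h, charFun (P.map (W h)) u =
        ∫ ω, Complex.exp (Complex.I * (u * W h ω : ℝ)) ∂P := by
      intro h
      rw [charFun_apply_real, integral_map (Lp.aestronglyMeasurable _).aemeasurable (by fun_prop)]
      refine integral_congr_ae (ae_of_all _ fun ω => ?_)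
      simp only
      congr 1; push_cast; ring
    have hexp : ∀ x y : ℝ, ‖Complex.exp (Complex.I * x) - Complex.exp (Complex.I * y)‖
        ≤ |x - y| := by
      intro x y
      have : Complex.exp (Complex.I * x) - Complex.exp (Complex.I * y) =
          Complex.exp (Complex.I * y) * (Complex.exp (Complex.I * (x - y : ℝ)) - 1) := by
        rw [mul_sub, ← Complex.exp_add]; push_cast; ring_nf
      rw [this, norm_mul, mul_comm Complex.I, Complex.norm_exp_ofReal_mul_I, one_mul]
      exact Real.norm_exp_I_mul_ofReal_sub_one_le
    have hmeas : ∀ h, AEStronglyMeasurable (W h) P := fun h => Lp.aestronglyMeasurable _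
    have hintg : ∀ h, Integrable (fun ω => Complex.exp (Complex.I * (u * W h ω : ℝ))) P := by
      intro h
      refine Integrable.of_bound (C := 1) ?_ (ae_of_all _ fun ω => ?_)
      · exact (by fun_prop : Continuous fun x : ℝ => Complex.exp (Complex.I * (u * x : ℝ)))
          |>.comp_aestronglyMeasurable (hmeas h)
      · rw [mul_comm, Complex.norm_exp_ofReal_mul_I]
    refine LipschitzWith.continuous (K := ‖u‖₊) (LipschitzWith.of_dist_le_mul fun h k => ?_)
    rw [hcf, hcf, dist_eq_norm, ← integral_sub (hintg h) (hintg k), dist_eq_norm]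
    have h2 : MemLp (fun ω => W h ω - W k ω) 2 P := (Lp.memLp _).sub (Lp.memLp _)
    calc _ ≤ ∫ ω, ‖u‖ * |W h ω - W k ω| ∂P := by
          refine norm_integral_le_of_norm_le
            ((h2.integrable (by norm_num)).abs.const_mul _) (ae_of_all _ fun ω => ?_)
          refine (hexp _ _).trans (le_of_eq ?_)
          rw [← mul_sub, abs_mul, Real.norm_eq_abs]
      _ = ‖u‖ * ∫ ω, |W h ω - W k ω| ∂P := integral_const_mul _ _
      _ ≤ ‖u‖ * ‖h - k‖ := by
          gcongr
          rw [← W.norm_map, map_sub, Lp.norm_def]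
          have e1 : ∫ ω, |W h ω - W k ω| ∂P = (eLpNorm (fun ω => W h ω - W k ω) 1 P).toReal := by
            rw [eLpNorm_one_eq_lintegral_enorm,
              ← integral_norm_eq_lintegral_enorm h2.aestronglyMeasurable]
            rfl
          rw [e1]
          have e2 : eLpNorm (W h - W k : Lp ℝ 2 P) 2 P = eLpNorm (fun ω => W h ω - W k ω) 2 P :=
            eLpNorm_congr_ae (Lp.coeFn_sub _ _)
          rw [e2]
          exact ENNReal.toReal_mono h2.eLpNorm_ne_top
            (eLpNorm_le_eLpNorm_of_exponent_le (by norm_num) h2.aestronglyMeasurable)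
      _ = _ := by simp
  have hspan : ∀ h ∈ Submodule.span ℝ (range b), HasGaussianLaw (W h) P ∧ ∫ ω, W h ω ∂P = 0 := by
    intro h hh
    obtain ⟨c, rfl⟩ := (Finsupp.mem_span_range_iff_exists_finsupp).1 hh
    have hsum : (W (c.sum fun i a => a • b i) : Ω → ℝ) =ᵐ[P]
        fun ω => ∑ i : c.support, c i * g i ω := by
      rw [Finsupp.sum, map_sum]
      refine (Lp.coeFn_finsetSum _ _).trans ?_
      have : ∀ᵐ ω ∂P, ∀ i : c.support, W (c i • b i) ω = c i * g i ω := by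
        rw [ae_all_iff]
        intro i
        rw [map_smul, hWb]
        filter_upwards [Lp.coeFn_smul (c i) ((hg2 i).toLp (g i)), (hg2 i).coeFn_toLp] with ω h1 h2
        rw [h1, Pi.smul_apply, h2, smul_eq_mul]
      filter_upwards [this] with ω hω
      rw [Finset.sum_apply, ← Finset.sum_coe_sort]
      exact Finset.sum_congr rfl fun i _ => hω i
    constructor
    · refine HasGaussianLaw.congr ?_ hsum.symm
      have hind : iIndepFun (fun (i : c.support) ω => c i * g i ω) P :=
        (hgi.precomp Subtype.val_injective).comp (fun (i : c.support) (x : ℝ) => c i * x)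
          fun i => measurable_const_mul _
      exact hind.hasGaussianLaw_fun_sum fun i => (hgl i).hasGaussianLaw.fun_smul (c i)
    · rw [integral_congr_ae hsum, integral_finsetSum _ fun (i : c.support) _ =>
        ((hg2 i).integrable (by norm_num)).const_mul (c i)]
      simp [integral_const_mul, hgint]
  have hdense : Dense (Submodule.span ℝ (range b) : Set H) :=
    (Submodule.dense_iff_topologicalClosure_eq_top).2 b.dense_span
  have hnorm : ∀ h, ∫ ω, W h ω * W h ω ∂P = ‖h‖ ^ 2 := by
    intro h
    rw [← W.norm_map, ← real_inner_self_eq_norm_sq, L2.inner_def]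
    simp [← pow_two]
  have hvar : ∀ h, ∫ ω, W h ω ∂P = 0 → Var[W h; P] = ‖h‖ ^ 2 := by
    intro h h0
    rw [variance_eq_sub (Lp.memLp _), h0]
    simpa [pow_two] using hnorm h
  have hall : ∀ h : H, ∀ u : ℝ, charFun (P.map (W h)) u =
      Complex.exp (-(u ^ 2 * ‖h‖ ^ 2 / 2 : ℝ)) := by
    intro h
    have := hdense.closure_eq ▸ mem_univ h
    refine hcl.closure_subset_iff.2 ?_ this
    intro k hk u
    obtain ⟨h1, h2⟩ := hspan k hk
    rw [h1.map_eq_gaussianReal, charFun_gaussianReal, h2, hvar k h2,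
      Real.coe_toNNReal _ (sq_nonneg _)]
    congr 1; push_cast; ring
  have hzero : ∀ h : H, ∫ ω, W h ω ∂P = 0 := by
    intro h
    have hc : IsClosed {h : H | ∫ ω, W h ω ∂P = 0} := by
      simp_rw [hint0]
      exact isClosed_eq (by fun_prop) continuous_const
    exact hc.closure_subset_iff.2 (fun k hk => (hspan k hk).2) (hdense.closure_eq ▸ mem_univ h)
  intro h
  refine ⟨?_, hzero h⟩
  have hm : AEMeasurable (W h) P := (Lp.aestronglyMeasurable _).aemeasurable
  have : HasLaw (W h) (gaussianReal 0 (‖h‖ ^ 2).toNNReal) P := by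
    refine ⟨hm, ?_⟩
    have := Measure.isProbabilityMeasure_map (μ := P) hm
    refine Measure.ext_of_charFun (funext fun u => ?_)
    rw [hall, charFun_gaussianReal, Real.coe_toNNReal _ (sq_nonneg _)]
    congr 1; push_cast; ring
  exact this.hasGaussianLaw

theorem exists_isPreBrownianReal :
    ∃ (Ω : Type) (_ : MeasurableSpace Ω) (P : Measure Ω) (B : ℝ≥0 → Ω → ℝ),
      IsProbabilityMeasure P ∧ IsPreBrownianReal B P := by
  obtain ⟨Ω, m, P, hP, W, hW⟩ := exists_isonormal (Lp ℝ 2 (volume : Measure ℝ))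
  let e : ℝ≥0 → Lp ℝ 2 (volume : Measure ℝ) := fun t =>
    indicatorConstLp 2 (measurableSet_Icc (a := (0 : ℝ)) (b := t)) (by simp) (1 : ℝ)
  refine ⟨Ω, m, P, fun t => W (e t), hP, ?_⟩
  refine IsGaussianProcess.isPreBrownianReal_of_covariance ⟨fun I => ⟨?_⟩⟩
    (fun t => (hW _).2) ?_
  · have hm : AEMeasurable (fun ω => I.restrict fun t => W (e t) ω) P :=
      aemeasurable_pi_lambda _ fun i => (Lp.aestronglyMeasurable (W (e i))).aemeasurable
    refine ⟨fun L => ?_⟩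
    have hL : (fun ω => L (I.restrict fun t => W (e t) ω)) =ᵐ[P]
        W (∑ i : I, L (Pi.single i 1) • e i) := by
      rw [map_sum]
      refine Filter.EventuallyEq.trans ?_ (Lp.coeFn_finsetSum _ _).symm
      have : ∀ᵐ ω ∂P, ∀ i : I, W (L (Pi.single i 1) • e i) ω = L (Pi.single i 1) * W (e i) ω := by
        rw [ae_all_iff]
        intro i
        rw [map_smul]
        filter_upwards [Lp.coeFn_smul (L (Pi.single i 1)) (W (e i))] with ω h1
        rw [h1, Pi.smul_apply, smul_eq_mul]
      filter_upwards [this] with ω hω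
      rw [Finset.sum_apply]
      simp only [hω]
      conv_lhs => rw [pi_eq_sum_univ' (I.restrict fun t => W (e t) ω)]
      rw [map_sum]
      refine Finset.sum_congr rfl fun i _ => ?_
      rw [map_smul, smul_eq_mul, mul_comm]
      congr
    have hg : HasGaussianLaw (fun ω => L (I.restrict fun t => W (e t) ω)) P :=
      (hW _).1.congr hL.symm
    have := hg.map_eq_gaussianReal
    have e1 : (P.map fun ω => I.restrict fun t => W (e t) ω).map L =
        P.map (fun ω => L (I.restrict fun t => W (e t) ω)) :=
      AEMeasurable.map_map_of_aemeasurable (by fun_prop) hm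
    rw [e1, this, integral_map hm (by fun_prop), variance_map (by fun_prop) hm]
    rfl
  · intro s t hst
    have h1 := (hW (e s)).2
    have h2 := (hW (e t)).2
    rw [covariance_eq_sub (Lp.memLp _) (Lp.memLp _), h1, zero_mul, sub_zero]
    have : inner ℝ (W (e s)) (W (e t)) = ∫ ω, W (e s) ω * W (e t) ω ∂P := by
      rw [L2.inner_def]
      have hxy : ∀ x y : ℝ, inner ℝ x y = x * y := fun x y => by simp [mul_comm]
      exact integral_congr_ae (ae_of_all _ fun ω => hxy _ _)
    change ∫ ω, W (e s) ω * W (e t) ω ∂P = _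
    rw [← this, W.inner_map_map, L2.real_inner_indicatorConstLp_one_indicatorConstLp_one _ _ (by simp) (by simp),
      Icc_inter_Icc]
    simp [hst]

/-- Dyadic step approximations of a function with geometrically small dyadic increments converge
locally uniformly to a continuous function. -/
theorem exists_continuous_tendsto_dyadic {f : ℝ≥0 → ℝ} {ρ : ℝ} (hρ0 : 0 < ρ) (hρ1 : ρ < 1)
    (h : ∀ N : ℕ, ∃ n₀ : ℕ, ∀ n ≥ n₀, ∀ k < N * 2 ^ n,
      |f ((k + 1 : ℕ) / 2 ^ n) - f (k / 2 ^ n)| ≤ ρ ^ n) :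
    ∃ F : ℝ≥0 → ℝ, Continuous F ∧
      ∀ t, Tendsto (fun n : ℕ => f (⌊t * 2 ^ n⌋₊ / 2 ^ n)) atTop (𝓝 (F t)) := by
  set A : ℕ → ℝ≥0 → ℝ := fun n t => f (⌊t * 2 ^ n⌋₊ / 2 ^ n) with hA
  have hlt : ∀ (N n : ℕ) (t : ℝ≥0), t < N → ⌊t * 2 ^ n⌋₊ < N * 2 ^ n := by
    intro N n t ht
    rw [Nat.floor_lt (by positivity)]
    push_cast
    gcongr
  have hstep : ∀ N : ℕ, ∃ n₀ : ℕ, ∀ t < (N : ℝ≥0), ∀ n,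
      dist (A (n₀ + n) t) (A (n₀ + (n + 1)) t) ≤ ρ ^ n₀ * ρ ^ n := by
    intro N
    obtain ⟨n₀, hn₀⟩ := h N
    refine ⟨n₀, fun t ht n => ?_⟩
    rw [← pow_add]
    generalize hm : n₀ + n = m
    have hm0 : n₀ ≤ m + 1 := by omega
    rw [show n₀ + (n + 1) = m + 1 by omega]
    have hk := hlt N m t ht
    have h1 : 2 * ⌊t * 2 ^ m⌋₊ ≤ ⌊t * 2 ^ (m + 1)⌋₊ := by
      rw [Nat.le_floor_iff (by positivity)]
      have := Nat.floor_le (show 0 ≤ t * 2 ^ m by positivity)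
      push_cast
      calc _ ≤ 2 * (t * 2 ^ m) := by gcongr
        _ = _ := by ring
    have h2 : ⌊t * 2 ^ (m + 1)⌋₊ < 2 * ⌊t * 2 ^ m⌋₊ + 2 := by
      rw [Nat.floor_lt (by positivity)]
      have := Nat.lt_floor_add_one (t * 2 ^ m)
      push_cast
      calc _ = 2 * (t * 2 ^ m) := by ring
        _ < 2 * (⌊t * 2 ^ m⌋₊ + 1) := by gcongr
        _ = _ := by ring
    have h3 : ((2 * ⌊t * 2 ^ m⌋₊ : ℕ) : ℝ≥0) / 2 ^ (m + 1) = ⌊t * 2 ^ m⌋₊ / 2 ^ m := by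
      push_cast
      rw [pow_succ]
      field_simp
    simp only [hA]
    rw [← h3, dist_comm, Real.dist_eq]
    rcases (by omega : ⌊t * 2 ^ (m + 1)⌋₊ = 2 * ⌊t * 2 ^ m⌋₊ ∨
        ⌊t * 2 ^ (m + 1)⌋₊ = 2 * ⌊t * 2 ^ m⌋₊ + 1) with h4 | h4
    · rw [h4, sub_self, abs_zero]; positivity
    · rw [h4]
      refine (hn₀ (m + 1) hm0 _ ?_).trans ?_
      · rw [pow_succ, ← mul_assoc, mul_comm _ 2]; omega
      · exact pow_le_pow_of_le_one hρ0.le hρ1.le (by omega)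
  have hex : ∀ t, ∃ x, Tendsto (fun n => A n t) atTop (𝓝 x) := by
    intro t
    obtain ⟨N, hN⟩ := exists_nat_gt t
    obtain ⟨n₀, hn₀⟩ := hstep N
    obtain ⟨x, hx⟩ := cauchySeq_tendsto_of_complete
      (cauchySeq_of_le_geometric ρ (ρ ^ n₀) hρ1 (hn₀ t hN))
    refine ⟨x, (tendsto_add_atTop_iff_nat n₀).1 ?_⟩
    simpa [add_comm] using hx
  choose F hF using hex
  refine ⟨F, ?_, hF⟩
  have hunif : ∀ N : ℕ, ∃ n₀ : ℕ, ∀ t < (N : ℝ≥0), ∀ n ≥ n₀,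
      dist (A n t) (F t) ≤ ρ ^ n * (1 / (1 - ρ)) := by
    intro N
    obtain ⟨n₀, hn₀⟩ := hstep N
    refine ⟨n₀, fun t ht n hn => ?_⟩
    have h1 : Tendsto (fun n => A (n₀ + n) t) atTop (𝓝 (F t)) := by
      simpa [add_comm] using (tendsto_add_atTop_iff_nat n₀).2 (hF t)
    have := dist_le_of_le_geometric_of_tendsto ρ (ρ ^ n₀) hρ1 (hn₀ t ht) h1 (n - n₀)
    rw [← pow_add, Nat.add_sub_cancel' hn] at this
    rwa [mul_one_div]
  have hclose : ∀ N : ℕ, ∃ n₀ : ℕ, ∀ n ≥ n₀, ∀ s t : ℝ≥0, s ≤ t → t < N →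
      t ≤ s + 1 / 2 ^ n → |A n t - A n s| ≤ ρ ^ n := by
    intro N
    obtain ⟨n₀, hn₀⟩ := h N
    refine ⟨n₀, fun n hn s t hst ht hd => ?_⟩
    have h1 : ⌊s * 2 ^ n⌋₊ ≤ ⌊t * 2 ^ n⌋₊ := Nat.floor_mono (by gcongr)
    have h2 : ⌊t * 2 ^ n⌋₊ < ⌊s * 2 ^ n⌋₊ + 2 := by
      rw [Nat.floor_lt (by positivity)]
      have := Nat.lt_floor_add_one (s * 2 ^ n)
      push_cast
      calc _ ≤ (s + 1 / 2 ^ n) * 2 ^ n := by gcongr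
        _ = s * 2 ^ n + 1 := by field_simp
        _ < (⌊s * 2 ^ n⌋₊ + 1) + 1 := by gcongr
        _ = _ := by ring
    simp only [hA]
    rcases (by omega : ⌊t * 2 ^ n⌋₊ = ⌊s * 2 ^ n⌋₊ ∨
        ⌊t * 2 ^ n⌋₊ = ⌊s * 2 ^ n⌋₊ + 1) with h4 | h4
    · rw [h4, sub_self, abs_zero]; positivity
    · rw [h4]
      exact hn₀ n hn _ (hlt N n s (hst.trans_lt ht))
  rw [Metric.continuous_iff]
  intro t ε hε
  obtain ⟨N, hN⟩ := exists_nat_gt (t + 1)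
  obtain ⟨n₁, hn₁⟩ := hunif N
  obtain ⟨n₂, hn₂⟩ := hclose N
  have hlim : Tendsto (fun n : ℕ => ρ ^ n * (2 * (1 / (1 - ρ)) + 1)) atTop (𝓝 0) := by
    simpa using (tendsto_pow_atTop_nhds_zero_of_lt_one hρ0.le hρ1).mul_const
      (2 * (1 / (1 - ρ)) + 1)
  obtain ⟨n, hn, hnε⟩ := ((eventually_ge_atTop (n₁ + n₂)).and
    (hlim.eventually_lt_const hε)).exists
  refine ⟨1 / 2 ^ n, by positivity, fun s hs => ?_⟩
  have hle1 : (1 : ℝ) / 2 ^ n ≤ 1 := by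
    rw [div_le_one (by positivity)]; exact one_le_pow₀ (by norm_num)
  rw [NNReal.dist_eq, abs_lt] at hs
  have hsN : s < N := by
    have : (s : ℝ) < t + 1 := by linarith
    exact lt_trans (by exact_mod_cast this) hN
  have htN : t < N := lt_of_le_of_lt (by simp) hN
  have hAA : |A n s - A n t| ≤ ρ ^ n := by
    rcases le_total s t with hst | hst
    · rw [abs_sub_comm]
      refine hn₂ n (by omega) s t hst htN ?_
      rw [← NNReal.coe_le_coe]; push_cast; linarith
    · refine hn₂ n (by omega) t s hst hsN ?_
      rw [← NNReal.coe_le_coe]; push_cast; linarith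
  have e1 := hn₁ s hsN n (by omega)
  have e2 := hn₁ t htN n (by omega)
  rw [Real.dist_eq, abs_le] at e1 e2
  rw [abs_le] at hAA
  rw [Real.dist_eq]
  refine lt_of_le_of_lt ?_ hnε
  rw [abs_le]
  constructor <;> linarith

/-- Fourth-moment tail bound for Brownian increments. -/
theorem exists_measureReal_increment_le {Ω : Type} {m : MeasurableSpace Ω} {P : Measure Ω}
    [IsProbabilityMeasure P] {B : ℝ≥0 → Ω → ℝ} (hB : IsPreBrownianReal B P) :
    ∃ C : ℝ, 0 ≤ C ∧ ∀ s t : ℝ≥0, ∀ ε > 0,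
      P.real {ω | ε ≤ |B s ω - B t ω|} ≤ C * (dist s t) ^ 2 / ε ^ 4 := by
  refine ⟨∫ x, x ^ 4 ∂gaussianReal 0 1, integral_nonneg fun x => by positivity, ?_⟩
  intro s t ε hε
  have hlaw := hB.hasLaw_sub s t
  have hinteg : Integrable (fun x : ℝ => x ^ 4) (gaussianReal 0 (nndist s.1 t.1)) := by
    have := (memLp_id_gaussianReal (μ := 0) (v := nndist s.1 t.1) 4).integrable_norm_pow (by norm_num)
    simpa [Even.pow_abs (show Even 4 by decide)] using this
  have hinteg' : Integrable (fun ω => (B s ω - B t ω) ^ 4) P := by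
    have := hlaw.map_eq ▸ hinteg
    exact (integrable_map_measure (by fun_prop) hlaw.aemeasurable).1 this
  have hmom : ∫ ω, (B s ω - B t ω) ^ 4 ∂P = (∫ x, x ^ 4 ∂gaussianReal 0 1) * dist s t ^ 2 := by
    have e1 : ∫ ω, (B s ω - B t ω) ^ 4 ∂P = ∫ x, x ^ 4 ∂gaussianReal 0 (nndist s.1 t.1) := by
      rw [← hlaw.map_eq, integral_map hlaw.aemeasurable (by fun_prop)]
      rfl
    have e2 : gaussianReal 0 (nndist s.1 t.1) =
        (gaussianReal 0 1).map (Real.sqrt (dist s t) * ·) := by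
      rw [gaussianReal_map_const_mul]
      congr 1
      · simp
      · ext
        simp [Real.sq_sqrt dist_nonneg]
        rfl
    rw [e1, e2, integral_map (by fun_prop) (by fun_prop)]
    have : ∀ x : ℝ, (√(dist s t) * x) ^ 4 = dist s t ^ 2 * x ^ 4 := fun x => by
      rw [mul_pow, show (√(dist s t)) ^ 4 = ((√(dist s t)) ^ 2) ^ 2 by ring,
        Real.sq_sqrt dist_nonneg]
    simp_rw [this]
    rw [integral_const_mul, mul_comm]
  have := mul_meas_ge_le_integral_of_nonneg (μ := P) (f := fun ω => (B s ω - B t ω) ^ 4)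
    (ae_of_all _ fun ω => by positivity) hinteg' (ε ^ 4)
  rw [le_div_iff₀ (by positivity), ← hmom, mul_comm]
  refine le_trans ?_ this
  refine mul_le_mul_of_nonneg_left (measureReal_mono (fun ω hω => ?_) (measure_ne_top P _))
    (by positivity)
  simp only [mem_ofPred_eq] at hω ⊢
  calc ε ^ 4 ≤ |B s ω - B t ω| ^ 4 := by gcongr
    _ = _ := by rw [← abs_pow, abs_of_nonneg (by positivity)]

theorem exists_continuous_modification {Ω : Type} {m : MeasurableSpace Ω} {P : Measure Ω}
    [IsProbabilityMeasure P] {B : ℝ≥0 → Ω → ℝ} (hB : IsPreBrownianReal B P) :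
    ∃ B' : ℝ≥0 → Ω → ℝ, (∀ ω, Continuous fun t => B' t ω) ∧ ∀ t, B t =ᵐ[P] B' t := by
  classical
  obtain ⟨C, hC0, hC⟩ := exists_measureReal_increment_le hB
  have hgood : ∀ᵐ ω ∂P, ∀ N : ℕ, ∃ n₀ : ℕ, ∀ n ≥ n₀, ∀ k < N * 2 ^ n,
      |B ((k + 1 : ℕ) / 2 ^ n) ω - B (k / 2 ^ n) ω| ≤ (9 / 10 : ℝ) ^ n := by
    rw [ae_all_iff]
    intro N
    let s : ℕ → Set Ω := fun n => ⋃ k ∈ Finset.range (N * 2 ^ n),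
      {ω | (9 / 10 : ℝ) ^ n ≤ |B ((k + 1 : ℕ) / 2 ^ n) ω - B (k / 2 ^ n) ω|}
    have hs : ∀ n, P.real (s n) ≤ (N * C) * (1 / (2 * (9 / 10) ^ 4)) ^ n := by
      intro n
      refine (measureReal_biUnion_finset_le _ _).trans ?_
      have : ∀ k ∈ Finset.range (N * 2 ^ n),
          P.real {ω | (9 / 10 : ℝ) ^ n ≤ |B ((k + 1 : ℕ) / 2 ^ n) ω - B (k / 2 ^ n) ω|} ≤
            C * (1 / 2 ^ n) ^ 2 / ((9 / 10) ^ n) ^ 4 := by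
        intro k _
        refine (hC _ _ _ (by positivity)).trans (le_of_eq ?_)
        congr 3
        rw [NNReal.dist_eq]
        push_cast
        rw [← sub_div, add_sub_cancel_left, abs_of_nonneg (by positivity)]
      refine (Finset.sum_le_sum this).trans (le_of_eq ?_)
      rw [Finset.sum_const, Finset.card_range, nsmul_eq_mul]
      push_cast
      rw [pow_right_comm, one_div_pow, one_div_pow, mul_pow]
      field_simp
    have hsum : ∑' n, P (s n) ≠ ∞ := by
      have h1 : ∀ n, P (s n) ≤ ENNReal.ofReal ((N * C) * (1 / (2 * (9 / 10) ^ 4)) ^ n) := fun n => by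
        rw [← ofReal_measureReal (measure_ne_top _ _)]
        exact ENNReal.ofReal_le_ofReal (hs n)
      refine ne_top_of_le_ne_top ?_ (ENNReal.tsum_le_tsum h1)
      refine Summable.tsum_ofReal_ne_top ?_
      exact (summable_geometric_of_lt_one (by positivity) (by norm_num)).mul_left _
    filter_upwards [ae_eventually_notMem hsum] with ω hω
    obtain ⟨n₀, hn₀⟩ := eventually_atTop.1 hω
    refine ⟨n₀, fun n hn k hk => ?_⟩
    have := hn₀ n hn
    simp only [s, mem_iUnion, not_exists, mem_ofPred_eq, not_le, Finset.mem_range] at this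
    exact (this k hk).le
  have hF : ∀ ω, ∃ F : ℝ≥0 → ℝ, Continuous F ∧
      ((∀ N : ℕ, ∃ n₀ : ℕ, ∀ n ≥ n₀, ∀ k < N * 2 ^ n,
      |B ((k + 1 : ℕ) / 2 ^ n) ω - B (k / 2 ^ n) ω| ≤ (9 / 10 : ℝ) ^ n) →
      ∀ t, Tendsto (fun n : ℕ => B (⌊t * 2 ^ n⌋₊ / 2 ^ n) ω) atTop (𝓝 (F t))) := by
    intro ω
    by_cases h : (∀ N : ℕ, ∃ n₀ : ℕ, ∀ n ≥ n₀, ∀ k < N * 2 ^ n,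
      |B ((k + 1 : ℕ) / 2 ^ n) ω - B (k / 2 ^ n) ω| ≤ (9 / 10 : ℝ) ^ n)
    · obtain ⟨F, h1, h2⟩ := exists_continuous_tendsto_dyadic (f := fun t => B t ω)
        (by norm_num) (by norm_num) h
      exact ⟨F, h1, fun _ => h2⟩
    · exact ⟨fun _ => 0, continuous_const, fun h' => absurd h' h⟩
  choose F hFc hFt using hF
  refine ⟨fun t ω => F ω t, hFc, fun t => ?_⟩
  have hmeas : TendstoInMeasure P (fun (n : ℕ) => B (⌊t * 2 ^ n⌋₊ / 2 ^ n)) atTop (B t) := by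
    rw [tendstoInMeasure_iff_measureReal_norm]
    intro ε hε
    have hbound : ∀ n : ℕ, P.real {ω | ε ≤ ‖B (⌊t * 2 ^ n⌋₊ / 2 ^ n) ω - B t ω‖} ≤
        C * (1 / 4 : ℝ) ^ n / ε ^ 4 := by
      intro n
      refine (hC _ t ε hε).trans ?_
      have hd : dist ((⌊t * 2 ^ n⌋₊ : ℝ≥0) / 2 ^ n) t ≤ 1 / 2 ^ n := by
        have h1 : (⌊t * 2 ^ n⌋₊ : ℝ≥0) ≤ t * 2 ^ n := Nat.floor_le (by positivity)
        have h2 : t * 2 ^ n < ⌊t * 2 ^ n⌋₊ + 1 := Nat.lt_floor_add_one _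
        rw [← NNReal.coe_le_coe] at h1
        rw [← NNReal.coe_lt_coe] at h2
        push_cast at h1 h2
        rw [NNReal.dist_eq]
        push_cast
        rw [abs_le]
        constructor
        · rw [neg_le_sub_iff_le_add, ← add_div, le_div_iff₀ (by positivity)]
          exact h2.le
        · have : (⌊t * 2 ^ n⌋₊ : ℝ) / 2 ^ n ≤ t := by
            rw [div_le_iff₀ (by positivity)]; exact h1
          have : (0 : ℝ) ≤ 1 / 2 ^ n := by positivity
          linarith
      have : dist ((⌊t * 2 ^ n⌋₊ : ℝ≥0) / 2 ^ n) t ^ 2 ≤ (1 / 4 : ℝ) ^ n := by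
        calc _ ≤ ((1 : ℝ) / 2 ^ n) ^ 2 := by gcongr
          _ = _ := by
            rw [div_pow, ← pow_mul, mul_comm, pow_mul, div_pow]; norm_num
      gcongr
    refine squeeze_zero (fun n => measureReal_nonneg) hbound ?_
    have := ((tendsto_pow_atTop_nhds_zero_of_lt_one (r := (1 / 4 : ℝ)) (by norm_num)
      (by norm_num)).const_mul C).div_const (ε ^ 4)
    simpa using this
  obtain ⟨ns, hns, hlim⟩ := hmeas.exists_seq_tendsto_ae
  filter_upwards [hlim, hgood] with ω h1 h2
  exact tendsto_nhds_unique h1 ((hFt ω h2 t).comp hns.tendsto_atTop)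

/-- Brownian motion with continuous paths on a complete probability space. -/
theorem exists_continuous_isPreBrownianReal :
    ∃ (Ω : Type) (_ : MeasurableSpace Ω) (P : Measure Ω) (B : ℝ≥0 → Ω → ℝ),
      IsProbabilityMeasure P ∧ P.IsComplete ∧ IsPreBrownianReal B P ∧
        (∀ t, Measurable (B t)) ∧ ∀ ω, Continuous fun t => B t ω := by
  obtain ⟨Ω, m, P, B, hP, hB⟩ := exists_isPreBrownianReal
  obtain ⟨B', hcont, hmod⟩ := exists_continuous_modification hB
  have hB' := hB.congr hmod
  have hPc : IsProbabilityMeasure P.completion :=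
    ⟨(P.completion_apply univ).trans hP.measure_univ⟩
  have hmeas : ∀ t, @Measurable (NullMeasurableSpace Ω P) ℝ _ _ (B' t) := by
    intro t s hs
    exact (hB'.aemeasurable t).nullMeasurable hs
  have hpi : ∀ I : Finset ℝ≥0, @Measurable (NullMeasurableSpace Ω P) (I → ℝ) _ _
      (fun ω => I.restrict fun x => B' x ω) := fun I => measurable_pi_lambda _ fun i => hmeas i
  refine ⟨NullMeasurableSpace Ω P, inferInstance, P.completion, B', hPc, inferInstance,
    ⟨fun I => ⟨(hpi I).aemeasurable, ?_⟩⟩, hmeas, hcont⟩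
  rw [← (hB'.hasLaw I).map_eq]
  ext s hs
  rw [Measure.map_apply_of_aemeasurable (hB'.hasLaw I).aemeasurable hs]
  exact (Measure.map_apply (hpi I) hs).trans (P.completion_apply _)

/-- The probability that `x + σ N` exceeds `q`, for `N` a standard Gaussian variable. -/
noncomputable def gaussTail (q σ x : ℝ) : ℝ := (gaussianReal 0 1).real {g | q < x + σ * g}

theorem gaussTail_mem_Icc (q σ x : ℝ) : gaussTail q σ x ∈ Icc (0 : ℝ) 1 :=
  ⟨measureReal_nonneg, measureReal_le_one⟩

theorem continuousAt_gaussTail (q : ℝ) (z : ℝ × ℝ) (hz : z.1 ≠ 0 ∨ z.2 ≠ q) :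
    ContinuousAt (fun z : ℝ × ℝ => gaussTail q z.1 z.2) z := by
  have hms : ∀ z : ℝ × ℝ, MeasurableSet {g : ℝ | q < z.2 + z.1 * g} := fun z =>
    (isOpen_lt continuous_const (by fun_prop)).measurableSet
  have h1 : (fun z : ℝ × ℝ => gaussTail q z.1 z.2) = fun z =>
      ∫ g, {g : ℝ | q < z.2 + z.1 * g}.indicator (1 : ℝ → ℝ) g ∂gaussianReal 0 1 := by
    ext z
    rw [integral_indicator_one (hms z)]
    rfl
  rw [h1]
  refine continuousAt_of_dominated (bound := fun _ => 1) (Eventually.of_forall fun z =>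
    (measurable_one.indicator (hms z)).aestronglyMeasurable)
    (Eventually.of_forall fun z => ae_of_all _ fun g => ?_) (integrable_const _) ?_
  · rw [Set.indicator_apply]; split_ifs <;> simp
  · have hne : ∀ᵐ g ∂gaussianReal 0 1, z.2 + z.1 * g ≠ q := by
      by_cases h0 : z.1 = 0
      · refine ae_of_all _ fun g => ?_
        simpa [h0] using hz
      · have := nullSingletonClass_gaussianReal (μ := 0) (v := 1) (by simp)
        have : ∀ᵐ g ∂gaussianReal 0 1, g ≠ (q - z.2) / z.1 := by
          rw [ae_iff]; simp
        filter_upwards [this] with g hg h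
        apply hg
        rw [eq_div_iff h0]; linarith
    filter_upwards [hne] with g hg
    rcases lt_or_gt_of_ne hg with h | h
    · have : ∀ᶠ w : ℝ × ℝ in 𝓝 z, w.2 + w.1 * g < q :=
        (by fun_prop : Continuous fun w : ℝ × ℝ => w.2 + w.1 * g).continuousAt.eventually_lt
          continuousAt_const h
      refine (continuousAt_const (y := (0 : ℝ))).congr ?_
      filter_upwards [this] with w hw
      rw [Set.indicator_of_notMem]
      simpa using hw.le
    · have : ∀ᶠ w : ℝ × ℝ in 𝓝 z, q < w.2 + w.1 * g :=
        continuousAt_const.eventually_lt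
        (by fun_prop : Continuous fun w : ℝ × ℝ => w.2 + w.1 * g).continuousAt h
      refine (continuousAt_const (y := (1 : ℝ))).congr ?_
      filter_upwards [this] with w hw
      rw [Set.indicator_of_mem]
      · rfl
      · exact hw

theorem exists_gaussTail_eq {θ : ℝ} (h0 : 0 < θ) (h1 : θ < 1) : ∃ q, gaussTail q 1 0 = θ := by
  have hc : Continuous fun x => gaussTail 0 1 x := by
    rw [continuous_iff_continuousAt]
    intro x
    exact (continuousAt_gaussTail 0 (1, x) (by simp)).comp
      (f := fun x : ℝ => ((1 : ℝ), x)) (by fun_prop)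
  have hF : ∀ x, gaussTail 0 1 x = 1 - cdf (gaussianReal 0 1) (-x) := by
    intro x
    rw [gaussTail, cdf_eq_real, ← probReal_compl_eq_one_sub measurableSet_Iic]
    congr 1
    ext g
    simp only [one_mul, mem_ofPred_eq, compl_Iic, mem_Ioi]
    constructor <;> intro <;> linarith
  obtain ⟨a, ha⟩ := ((tendsto_cdf_atBot (gaussianReal 0 1)).eventually_lt_const
    (sub_pos.2 h1)).exists
  obtain ⟨b, hb⟩ := ((tendsto_cdf_atTop (gaussianReal 0 1)).eventually_const_lt
    (sub_lt_self 1 h0)).exists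
  obtain ⟨x, hx⟩ : θ ∈ range fun x => gaussTail 0 1 x := mem_range_of_exists_le_of_exists_ge hc
    ⟨-b, by simp only [hF, neg_neg]; linarith⟩ ⟨-a, by simp only [hF, neg_neg]; linarith⟩
  refine ⟨-x, ?_⟩
  rw [← hx]
  unfold gaussTail
  congr 1
  ext g
  simp only [one_mul, mem_ofPred_eq]
  constructor <;> intro <;> linarith

theorem gaussTail_zero_left (q x : ℝ) : gaussTail q 0 x = if q < x then 1 else 0 := by
  unfold gaussTail
  split_ifs with h <;> simp [h]

theorem gaussianReal_real_setOf_lt {σ : ℝ} {v : ℝ≥0} (hσ : (v : ℝ) = σ ^ 2) (q x : ℝ) :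
    (gaussianReal 0 v).real {y | q < x + y} = gaussTail q σ x := by
  have h : gaussianReal 0 v = (gaussianReal 0 1).map (σ * ·) := by
    rw [gaussianReal_map_const_mul]
    congr 1
    · simp
    · ext
      simpa using hσ
  have hms : MeasurableSet {y : ℝ | q < x + y} :=
    (isOpen_lt continuous_const (by fun_prop)).measurableSet
  rw [h, map_measureReal_apply (by fun_prop) hms]
  rfl

theorem integral_comp_indepFun {Ω α : Type*} {m : MeasurableSpace Ω} {P : Measure Ω}
    [IsProbabilityMeasure P] [MeasurableSpace α] {U : Ω → α} {Y : Ω → ℝ} (hU : Measurable U)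
    (hY : Measurable Y) (hUY : IndepFun U Y P) {f : α → ℝ → ℝ} (hf : Measurable (Function.uncurry f))
    (hb : ∀ u y, |f u y| ≤ 1) :
    ∫ ω, f (U ω) (Y ω) ∂P = ∫ ω, ∫ y, f (U ω) y ∂(P.map Y) ∂P := by
  have := Measure.isProbabilityMeasure_map (μ := P) hU.aemeasurable
  have := Measure.isProbabilityMeasure_map (μ := P) hY.aemeasurable
  have h1 := (indepFun_iff_map_prod_eq_prod_map_map hU.aemeasurable hY.aemeasurable).1 hUY
  have h2 : ∫ ω, f (U ω) (Y ω) ∂P = ∫ z, Function.uncurry f z ∂((P.map U).prod (P.map Y)) := by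
    rw [← h1, integral_map (by fun_prop) hf.aestronglyMeasurable]
    rfl
  rw [h2, integral_prod _ (Integrable.of_bound hf.aestronglyMeasurable 1
    (ae_of_all _ fun z => hb z.1 z.2)), integral_map hU.aemeasurable]
  · rfl
  · exact hf.stronglyMeasurable.integral_prod_right.aestronglyMeasurable

theorem measurable_gaussTail (q σ : ℝ) : Measurable (gaussTail q σ) := by
  by_cases h : σ = 0
  · subst h
    have : gaussTail q 0 = fun x => if q < x then 1 else 0 := funext (gaussTail_zero_left q)
    rw [this]
    exact Measurable.ite measurableSet_Ioi measurable_const measurable_const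
  · refine Continuous.measurable (continuous_iff_continuousAt.2 fun x => ?_)
    exact (continuousAt_gaussTail q (σ, x) (by simp [h])).comp
      (f := fun x : ℝ => (σ, x)) (by fun_prop)

/-- The filtration generated by a process, augmented by all null sets. -/
noncomputable def augmentedFiltration {Ω : Type*} {m : MeasurableSpace Ω} (P : Measure Ω)
    [P.IsComplete] (B : ℝ≥0 → Ω → ℝ) (hB : ∀ t, Measurable (B t)) : Filtration ℝ≥0 m where
  seq t := eventuallyMeasurableSpace
    (MeasurableSpace.comap (fun ω (s : Iic t) => B s ω) MeasurableSpace.pi) (ae P)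
  mono' := by
    intro s t hst A hA
    obtain ⟨A', hA', hAA'⟩ := hA
    refine ⟨A', ?_, hAA'⟩
    obtain ⟨S, hS, rfl⟩ := hA'
    exact ⟨(fun (u : Iic t → ℝ) (r : Iic s) => u ⟨r, r.2.trans hst⟩) ⁻¹' S,
      measurableSet_preimage (measurable_pi_lambda _ fun r => measurable_pi_apply _) hS, rfl⟩
  le' := by
    intro t A hA
    obtain ⟨A', hA', hAA'⟩ := hA
    have h1 : MeasurableSet A' :=
      (measurable_pi_lambda (fun ω (s : Iic t) => B s ω) fun s => hB s).comap_le _ hA'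
    exact (h1.nullMeasurableSet.congr hAA'.symm).measurable_of_complete

theorem measurable_augmentedFiltration_congr {Ω : Type*} {m : MeasurableSpace Ω} {P : Measure Ω}
    [P.IsComplete] {B : ℝ≥0 → Ω → ℝ} (hB : ∀ t, Measurable (B t)) (t : ℝ≥0) {f g : Ω → ℝ}
    (hfg : f =ᵐ[P] g) (hg : Measurable[augmentedFiltration P B hB t] g) :
    Measurable[augmentedFiltration P B hB t] f :=
  EventuallyMeasurable.congr (m := MeasurableSpace.comap (fun ω (s : Iic t) => B s ω)
    MeasurableSpace.pi) (l := ae P) hg hfg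

set_option maxHeartbeats 1000000 in
-- The construction is elaborated as one block of local definitions.
theorem exists_continuous_bernoulli_martingale {Ω : Type} {m : MeasurableSpace Ω} (P : Measure Ω)
    [IsProbabilityMeasure P] [P.IsComplete] (B : ℝ≥0 → Ω → ℝ) (hBm : ∀ t, Measurable (B t))
    (hB : IsPreBrownianReal B P) (hBc : ∀ ω, Continuous fun t => B t ω)
    (n : ℕ) {θ : ℝ} (hθ : θ ∈ Icc (0 : ℝ) 1) :
    ∃ V : ℝ≥0 → Ω → ℝ, Martingale V (augmentedFiltration P B hBm) P ∧
      (∀ ω, Continuous fun t => V t ω) ∧ (∀ t ω, V t ω ∈ Icc (0 : ℝ) 1) ∧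
      (∀ t ≤ (n : ℝ≥0), ∀ ω, V t ω = θ) ∧
      (∀ t ≥ (n + 1 : ℝ≥0), ∀ ω, V t ω = V (n + 1) ω) ∧
      ∀ ω, V (n + 1) ω = 0 ∨ V (n + 1) ω = 1 := by
  classical
  by_cases hθ' : θ = 0 ∨ θ = 1
  · exact ⟨fun _ _ => θ, martingale_const _ _ _, fun _ => continuous_const, fun _ _ => hθ,
      fun _ _ _ => rfl, fun _ _ _ => rfl, fun _ => hθ'⟩
  rw [not_or] at hθ'
  obtain ⟨q, hq⟩ := exists_gaussTail_eq (lt_of_le_of_ne hθ.1 (Ne.symm hθ'.1))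
    (lt_of_le_of_ne hθ.2 hθ'.2)
  set ℱ := augmentedFiltration P B hBm with hℱ
  let c : ℝ≥0 → ℝ≥0 := fun t => max n (min t (n + 1))
  have hcn : ∀ t, (n : ℝ≥0) ≤ c t := fun t => le_max_left _ _
  have hcn1 : ∀ t, c t ≤ n + 1 := fun t => max_le (by simp) (min_le_right _ _)
  have hc_of_le : ∀ t ≤ (n : ℝ≥0), c t = n := fun t ht =>
    max_eq_left ((min_le_left _ _).trans ht)
  have hc_of_ge : ∀ t ≥ (n + 1 : ℝ≥0), c t = n + 1 := fun t ht => by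
    simp only [c]; rw [min_eq_right ht]; exact max_eq_right (by simp)
  have hc_of_mem : ∀ t : ℝ≥0, n ≤ t → t ≤ n + 1 → c t = t := fun t h1 h2 => by
    simp only [c]; rw [min_eq_left h2]; exact max_eq_right h1
  have hcc : Continuous c := by fun_prop
  let σ : ℝ≥0 → ℝ := fun t => √((n + 1 : ℝ) - c t)
  let V₀ : ℝ≥0 → Ω → ℝ := fun t ω => gaussTail q (σ t) (B (c t) ω - B n ω)
  let bad : Set Ω := {ω | B (n + 1) ω - B n ω = q}
  have hbad : ∀ᵐ ω ∂P, ω ∉ bad := by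
    have hlaw := hB.hasLaw_sub (n + 1) n
    have h1 : P.map (B (n + 1) - B n) {q} = 0 := by
      rw [hlaw.map_eq]
      refine @measure_singleton _ _ _ (nullSingletonClass_gaussianReal ?_) q
      rw [← NNReal.coe_ne_zero]
      simp
    rw [Measure.map_apply ((hBm _).sub (hBm _)) (measurableSet_singleton q)] at h1
    exact measure_eq_zero_iff_ae_notMem.1 h1
  let V : ℝ≥0 → Ω → ℝ := fun t ω => if ω ∈ bad then θ + (1 - θ) * (c t - n) else V₀ t ω
  have hVV₀ : ∀ t, V t =ᵐ[P] V₀ t := fun t => by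
    filter_upwards [hbad] with ω hω
    simp [V, hω]
  have hV₀m : ∀ t, Measurable (V₀ t) := fun t =>
    (measurable_gaussTail q (σ t)).comp ((hBm _).sub (hBm _))
  have hV₀b : ∀ t ω, V₀ t ω ∈ Icc (0 : ℝ) 1 := fun t ω => gaussTail_mem_Icc _ _ _
  have hV₀i : ∀ t, Integrable (V₀ t) P := fun t =>
    Integrable.of_bound (hV₀m t).aestronglyMeasurable 1 (ae_of_all _ fun ω => by
      rw [Real.norm_eq_abs, abs_of_nonneg (hV₀b t ω).1]; exact (hV₀b t ω).2)
  have hσ1 : ∀ t ≥ (n + 1 : ℝ≥0), σ t = 0 := fun t ht => by simp [σ, hc_of_ge t ht]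
  have hσ0 : ∀ t ≤ (n : ℝ≥0), σ t = 1 := fun t ht => by simp [σ, hc_of_le t ht]
  have hadapt : ∀ t : ℝ≥0, n ≤ t → t ≤ n + 1 → Measurable[ℱ t] (V₀ t) := by
    intro t h1 h2
    have : V₀ t = (fun u : Iic t → ℝ => gaussTail q (σ t) (u ⟨t, mem_Iic.2 le_rfl⟩ - u ⟨n, h1⟩)) ∘
        fun ω (s : Iic t) => B s ω := by
      ext ω
      simp only [V₀, hc_of_mem t h1 h2, Function.comp]
    rw [this]
    refine Measurable.mono (?_ : Measurable[MeasurableSpace.comap (fun ω (s : Iic t) => B s ω)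
      MeasurableSpace.pi] _) le_eventuallyMeasurableSpace le_rfl
    refine Measurable.comp ?_ (comap_measurable _)
    exact (measurable_gaussTail q (σ t)).comp ((measurable_pi_apply _).sub (measurable_pi_apply _))
  have hmid : ∀ t : ℝ≥0, n ≤ t → t ≤ n + 1 → V₀ t =ᵐ[P] P[V₀ (n + 1) | ℱ t] := by
    intro t h1 h2
    refine ae_eq_condExp_of_forall_setIntegral_eq (ℱ.le t) (hV₀i _)
      (fun _ _ _ => (hV₀i t).integrableOn) ?_ (hadapt t h1 h2).aestronglyMeasurable
    rintro A ⟨A', ⟨S, hS, rfl⟩, hAA'⟩ -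
    rw [setIntegral_congr_set hAA', setIntegral_congr_set hAA']
    set U : Ω → (Iic t → ℝ) := fun ω s => B s ω with hU
    have hUm : Measurable U := measurable_pi_lambda _ fun s => hBm s
    let Y : Ω → ℝ := fun ω => B (n + 1) ω - B t ω
    have hYm : Measurable Y := (hBm _).sub (hBm _)
    have hind : IndepFun U Y P := by
      have := (hB.indepFun_shift t).symm.comp measurable_id
        (measurable_pi_apply (n + 1 - t : ℝ≥0))
      simpa [Function.comp_def, add_tsub_cancel_of_le h2] using this
    have hYlaw : P.map Y = gaussianReal 0 (nndist ((n + 1 : ℝ≥0) : ℝ) t) :=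
      (hB.hasLaw_sub (n + 1) t).map_eq
    have hnn : ((nndist ((n + 1 : ℝ≥0) : ℝ) t : ℝ≥0) : ℝ) = σ t ^ 2 := by
      have h3 : (t : ℝ) ≤ n + 1 := by exact_mod_cast h2
      simp only [σ, hc_of_mem t h1 h2]
      rw [Real.sq_sqrt (by linarith), coe_nndist, Real.dist_eq]
      push_cast
      rw [abs_of_nonneg (by linarith)]
    let D : Set ((Iic t → ℝ) × ℝ) :=
      {z | z.1 ∈ S ∧ q < (z.1 ⟨t, mem_Iic.2 le_rfl⟩ - z.1 ⟨n, h1⟩) + z.2}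
    have hD : MeasurableSet D := by
      have h3 : MeasurableSet {z : (Iic t → ℝ) × ℝ |
          q < (z.1 ⟨t, mem_Iic.2 le_rfl⟩ - z.1 ⟨n, h1⟩) + z.2} :=
        measurableSet_lt measurable_const (by fun_prop)
      exact (measurable_fst hS).inter h3
    let f : (Iic t → ℝ) → ℝ → ℝ := fun u y => D.indicator 1 (u, y)
    have hf : Measurable (Function.uncurry f) := measurable_one.indicator hD
    have key := integral_comp_indepFun hUm hYm hind hf (fun u y => by
      simp only [f, Set.indicator_apply]; split_ifs <;> simp)
    rw [← integral_indicator (hUm hS), ← integral_indicator (hUm hS)]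
    have e1 : ∀ ω, (U ⁻¹' S).indicator (V₀ (n + 1)) ω = f (U ω) (Y ω) := by
      intro ω
      simp only [f, D, V₀, hσ1 _ le_rfl, hc_of_ge _ le_rfl, gaussTail_zero_left,
        Set.indicator_apply, mem_preimage, mem_ofPred_eq, U, Y]
      by_cases hω : (fun s : Iic t => B s ω) ∈ S <;> simp [hω]
    have e2 : ∀ ω, (U ⁻¹' S).indicator (V₀ t) ω = ∫ y, f (U ω) y ∂(P.map Y) := by
      intro ω
      by_cases hω : U ω ∈ S
      · rw [Set.indicator_of_mem (show ω ∈ U ⁻¹' S from hω)]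
        have : ∀ y, f (U ω) y = {y | q < (B t ω - B n ω) + y}.indicator 1 y := by
          intro y
          simp [f, D, Set.indicator_apply, hω, U]
        simp_rw [this]
        rw [integral_indicator_one (measurableSet_lt measurable_const (by fun_prop)), hYlaw,
          gaussianReal_real_setOf_lt hnn]
        simp only [V₀, hc_of_mem t h1 h2]
      · rw [Set.indicator_of_notMem (show ω ∉ U ⁻¹' S from hω)]
        have : ∀ y, f (U ω) y = 0 := by
          intro y
          simp [f, D, hω]
        simp [this]
    simp_rw [e1, e2]
    exact key.symm
  have hV₀n : ∀ t ≤ (n : ℝ≥0), ∀ ω, V₀ t ω = θ := by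
    intro t ht ω
    simp only [V₀, hσ0 t ht, hc_of_le t ht, sub_self, hq]
  have hcond : ∀ t, V₀ t =ᵐ[P] P[V₀ (n + 1) | ℱ t] := by
    intro t
    rcases le_total t n with h1 | h1
    · have h3 := (hmid n le_rfl (by simp))
      have h4 : P[P[V₀ (n + 1) | ℱ n] | ℱ t] =ᵐ[P] P[V₀ (n + 1) | ℱ t] :=
        condExp_condExp_of_le (ℱ.mono h1) (ℱ.le _)
      refine Filter.EventuallyEq.trans ?_ ((condExp_congr_ae h3).trans h4)
      have e : V₀ n = fun _ => θ := funext (hV₀n n le_rfl)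
      rw [e, condExp_const (ℱ.le t)]
      exact ae_of_all _ (hV₀n t h1)
    · rcases le_total t (n + 1) with h2 | h2
      · exact hmid t h1 h2
      · have e : V₀ t = V₀ (n + 1) := by
          ext ω
          simp only [V₀, hσ1 t h2, hσ1 _ le_rfl, hc_of_ge t h2, hc_of_ge _ le_rfl]
        rw [e, condExp_of_stronglyMeasurable (ℱ.le t) _ (hV₀i _)]
        exact ((hadapt (n + 1) (by simp) le_rfl).mono (ℱ.mono h2) le_rfl).stronglyMeasurable
  have hVc : ∀ t, V t =ᵐ[P] P[V₀ (n + 1) | ℱ t] := fun t => (hVV₀ t).trans (hcond t)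
  refine ⟨V, ⟨fun t => ?_, fun s t hst => ?_⟩, ?_, ?_, ?_, ?_, ?_⟩
  · exact (measurable_augmentedFiltration_congr hBm t (hVc t)
      stronglyMeasurable_condExp.measurable).stronglyMeasurable
  · exact (condExp_congr_ae (hVc t)).trans
      ((condExp_condExp_of_le (ℱ.mono hst) (ℱ.le t)).trans (hVc s).symm)
  · intro ω
    by_cases hω : ω ∈ bad
    · simp only [V, hω, if_true]; fun_prop
    · simp only [V, hω, if_false]
      rw [continuous_iff_continuousAt]
      intro t
      have h1 : ContinuousAt (fun t => (σ t, B (c t) ω - B n ω)) t := by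
        have := (hBc ω).comp hcc
        simp only [σ]
        exact Continuous.continuousAt (by fun_prop)
      refine ContinuousAt.comp (g := fun z : ℝ × ℝ => gaussTail q z.1 z.2)
        (continuousAt_gaussTail q _ ?_) h1
      by_contra! h
      simp only at h
      have h2 : c t = n + 1 := by
        refine le_antisymm (hcn1 t) ?_
        have := Real.sqrt_eq_zero'.1 h.1
        rw [← NNReal.coe_le_coe]
        push_cast
        linarith
      rw [h2] at h
      exact hω h.2
  · intro t ω
    by_cases hω : ω ∈ bad
    · simp only [V, hω, if_true]
      have h1 : (n : ℝ) ≤ c t := by exact_mod_cast hcn t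
      have h2 : (c t : ℝ) ≤ n + 1 := by exact_mod_cast hcn1 t
      constructor <;> nlinarith [hθ.1, hθ.2]
    · simp only [V, hω, if_false]
      exact hV₀b t ω
  · intro t ht ω
    by_cases hω : ω ∈ bad
    · simp [V, hω, hc_of_le t ht]
    · simp only [V, hω, if_false]
      exact hV₀n t ht ω
  · intro t ht ω
    simp only [V, V₀, hσ1 t ht, hσ1 _ le_rfl, hc_of_ge t ht, hc_of_ge _ le_rfl]
  · intro ω
    by_cases hω : ω ∈ bad
    · right
      simp [V, hω, hc_of_ge _ le_rfl]
    · simp only [V, V₀, hω, if_false, hσ1 _ le_rfl, gaussTail_zero_left]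
      split_ifs <;> simp

theorem MeasureTheory.Martingale.indicator_of_eq_zero {Ω : Type*} {m : MeasurableSpace Ω}
    {P : Measure Ω} [IsProbabilityMeasure P] {ℱ : Filtration ℝ≥0 m} {W : ℝ≥0 → Ω → ℝ}
    (hW : Martingale W ℱ P) {r : ℝ≥0} (hr : ∀ t ≤ r, W t = 0) {A : Set Ω}
    (hA : MeasurableSet[ℱ r] A) : Martingale (fun t => A.indicator (W t)) ℱ P := by
  have key : ∀ s t, r ≤ s → s ≤ t → P[A.indicator (W t) | ℱ s] =ᵐ[P] A.indicator (W s) := by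
    intro s t hrs hst
    refine (condExp_indicator (hW.integrable t) (ℱ.mono hrs _ hA)).trans ?_
    filter_upwards [hW.2 s t hst] with ω hω
    by_cases h : ω ∈ A
    · rw [indicator_of_mem h, indicator_of_mem h, hω]
    · rw [indicator_of_notMem h, indicator_of_notMem h]
  refine ⟨fun t => ?_, fun s t hst => ?_⟩
  · rcases le_total t r with h | h
    · simp only [hr t h, Set.indicator_zero']
      exact stronglyMeasurable_zero
    · exact (hW.1 t).indicator (ℱ.mono h _ hA)
  · rcases le_total t r with h | h
    · simp only [hr t h, hr s (hst.trans h), Set.indicator_zero', condExp_zero, EventuallyEq.rfl]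
    · rcases le_total r s with h' | h'
      · exact key s t h' hst
      · have h1 := key r t le_rfl h
        have h2 : P[P[A.indicator (W t) | ℱ r] | ℱ s] =ᵐ[P] P[A.indicator (W t) | ℱ s] :=
          condExp_condExp_of_le (ℱ.mono h') (ℱ.le _)
        refine h2.symm.trans ((condExp_congr_ae h1).trans ?_)
        simp [hr r le_rfl, hr s h']

/-- The Markov chain driven by the indicators `V n s (n + 1)`: at time `n` in state `s` it moves
up if `V n s (n + 1) = 1`, and down otherwise. -/
noncomputable def drivenChain {Ω S : Type*} (up down : S → S) (s₀ : S)
    (V : ℕ → S → ℝ≥0 → Ω → ℝ) : ℕ → Ω → S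
  | 0, _ => s₀
  | n + 1, ω =>
    open Classical in
    if V n (drivenChain up down s₀ V n ω) (n + 1) ω = 1 then up (drivenChain up down s₀ V n ω)
    else down (drivenChain up down s₀ V n ω)

/-- A random walk on a set of states, with real values balanced along the transitions, can be
interpolated by a continuous martingale. -/
theorem exists_continuous_martingale_interpolation {S : Type} (val : S → ℝ) (up down : S → S)
    (θ : S → ℝ) (hθ : ∀ s, θ s ∈ Icc (0 : ℝ) 1)
    (hval : ∀ s, θ s * val (up s) + (1 - θ s) * val (down s) = val s) (s₀ : S) (N : ℕ) :
    ∃ (Ω : Type) (m0 : MeasurableSpace Ω) (P : Measure Ω),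
      IsProbabilityMeasure P ∧ P.IsComplete ∧
      ∃ (ℱ : Filtration ℝ≥0 m0) (X : ℝ≥0 → Ω → ℝ) (C : ℕ → Ω → S),
        Martingale X ℱ P ∧ (∀ ω, Continuous fun t => X t ω) ∧
        (∀ ω, C 0 ω = s₀) ∧ (∀ n ω, C (n + 1) ω = up (C n ω) ∨ C (n + 1) ω = down (C n ω)) ∧
        (∀ n ≤ N, ∀ ω, X n ω = val (C n ω)) ∧
        (∀ n < N, ∀ t : ℝ≥0, n ≤ t → t ≤ n + 1 → ∀ ω,
          X t ω ∈ uIcc (val (up (C n ω))) (val (down (C n ω)))) ∧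
        (∀ t ≥ (N : ℝ≥0), ∀ ω, X t ω = X N ω) ∧
        (∀ n (f : S → ℝ), Integrable (fun ω => f (C n ω)) P) ∧
        ∀ n (f : S → ℝ), ∫ ω, f (C (n + 1) ω) ∂P =
          ∫ ω, θ (C n ω) * f (up (C n ω)) + (1 - θ (C n ω)) * f (down (C n ω)) ∂P := by
  classical
  obtain ⟨Ω, m0, P, B, hP, hPc, hB, hBm, hBc⟩ := exists_continuous_isPreBrownianReal
  refine ⟨Ω, m0, P, hP, hPc, ?_⟩
  have hV := fun (n : ℕ) (s : S) =>
    exists_continuous_bernoulli_martingale P B hBm hB hBc n (hθ s)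
  choose V hVM hVc hVb hV0 hV1 hVe using hV
  set ℱ := augmentedFiltration P B hBm
  set C := drivenChain up down s₀ V with hC
  have hC0 : ∀ ω, C 0 ω = s₀ := fun ω => rfl
  have hCs : ∀ n ω, C (n + 1) ω =
      if V n (C n ω) (n + 1) ω = 1 then up (C n ω) else down (C n ω) := fun n ω => rfl
  have hfin : ∀ n, ∃ R : Finset S, ∀ ω, C n ω ∈ R := by
    intro n
    induction n with
    | zero => exact ⟨{s₀}, fun ω => by simp [hC0]⟩
    | succ n ih =>
      obtain ⟨R, hR⟩ := ih
      refine ⟨R.image up ∪ R.image down, fun ω => ?_⟩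
      rw [hCs, Finset.mem_union]
      split_ifs
      · exact Or.inl (Finset.mem_image_of_mem _ (hR ω))
      · exact Or.inr (Finset.mem_image_of_mem _ (hR ω))
  choose R hR using hfin
  have hsum : ∀ n ω (F : S → ℝ), F (C n ω) = ∑ s ∈ R n, {ω | C n ω = s}.indicator
      (fun _ => F s) ω := by
    intro n ω F
    simp only [Set.indicator_apply, mem_ofPred_eq]
    rw [Finset.sum_ite_eq]
    simp [hR n ω]
  have hCm : ∀ (n : ℕ) s, MeasurableSet[ℱ n] {ω | C n ω = s} := by
    intro n
    induction n with
    | zero =>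
      intro s
      simp only [hC0]
      exact MeasurableSet.const _
    | succ n ih =>
      intro s
      have h1 : {ω | C (n + 1) ω = s} = ⋃ s' ∈ R n, {ω | C n ω = s'} ∩
          ({ω | V n s' (n + 1) ω = 1 ∧ up s' = s} ∪ {ω | V n s' (n + 1) ω ≠ 1 ∧ down s' = s}) := by
        ext ω
        simp only [mem_ofPred_eq, mem_iUnion, mem_inter_iff, mem_union, exists_prop]
        rw [hCs]
        constructor
        · intro h
          refine ⟨C n ω, hR n ω, rfl, ?_⟩
          split_ifs at h with h'
          · exact Or.inl ⟨h', h⟩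
          · exact Or.inr ⟨h', h⟩
        · rintro ⟨s', -, rfl, h | h⟩
          · rw [if_pos h.1, h.2]
          · rw [if_neg h.1, h.2]
      rw [h1]
      refine Finset.measurableSet_biUnion _ fun s' _ => ?_
      have hle : (n : ℝ≥0) ≤ ((n + 1 : ℕ) : ℝ≥0) := by push_cast; simp
      refine (ℱ.mono hle _ (ih s')).inter ?_
      have h2 : MeasurableSet[ℱ ((n + 1 : ℕ) : ℝ≥0)] {ω | V n s' (n + 1) ω = 1} := by
        have := ((hVM n s').1 ((n + 1 : ℕ) : ℝ≥0)).measurable (measurableSet_singleton 1)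
        push_cast at this ⊢
        exact this
      exact (h2.inter (m := ℱ ((n + 1 : ℕ) : ℝ≥0)) (.const (up s' = s))).union
        ((MeasurableSet.compl (m := ℱ ((n + 1 : ℕ) : ℝ≥0)) h2).inter (.const (down s' = s)))
  have hterm : ∀ n (g : S → ℝ), Martingale
      (fun t ω => g (C n ω) * (V n (C n ω) t ω - θ (C n ω))) ℱ P := by
    intro n g
    have h1 : (fun t ω => g (C n ω) * (V n (C n ω) t ω - θ (C n ω))) =
        ∑ s ∈ R n, fun t => {ω | C n ω = s}.indicator (g s • (V n s t - fun _ => θ s)) := by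
      ext t ω
      simp only [Finset.sum_apply]
      rw [hsum n ω (fun s => g s * (V n s t ω - θ s))]
      simp [Set.indicator_apply]
    rw [h1]
    refine Finset.sum_induction _ (fun f => Martingale f ℱ P) (fun _ _ h h' => h.add h')
      (martingale_zero _ _ _) fun s _ => ?_
    refine Martingale.indicator_of_eq_zero (W := fun t => g s • (V n s t - fun _ => θ s))
      (((hVM n s).sub (martingale_const ℱ P (θ s))).smul (g s)) (r := n) (fun t ht => ?_) (hCm n s)
    ext ω
    simp [hV0 n s t ht ω]
  have hinteg : ∀ n (f : S → ℝ), Integrable (fun ω => f (C n ω)) P := by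
    intro n f
    simp_rw [hsum n _ f]
    exact integrable_finsetSum _ fun s _ =>
      (integrable_const _).indicator (ℱ.le n _ (hCm n s))
  let D : ℕ → ℝ≥0 → Ω → ℝ := fun n t ω =>
    (val (up (C n ω)) - val (down (C n ω))) * (V n (C n ω) t ω - θ (C n ω))
  have hD0 : ∀ (n : ℕ) t ω, t ≤ (n : ℝ≥0) → D n t ω = 0 := fun n t ω ht => by
    simp [D, hV0 n _ t ht ω]
  have hDV : ∀ n t ω, val (C n ω) + D n t ω =
      V n (C n ω) t ω * val (up (C n ω)) + (1 - V n (C n ω) t ω) * val (down (C n ω)) := by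
    intro n t ω
    rw [← hval (C n ω)]
    simp only [D]
    ring
  have hD1 : ∀ (n : ℕ) t ω, (n + 1 : ℝ≥0) ≤ t → D n t ω = val (C (n + 1) ω) - val (C n ω) := by
    intro n t ω ht
    rw [eq_sub_iff_add_eq', hDV, hV1 n _ t ht, hCs]
    rcases hVe n (C n ω) ω with h | h <;> simp [h]
  let X : ℝ≥0 → Ω → ℝ := fun t ω => val s₀ + ∑ n ∈ Finset.range N, D n t ω
  have hXD : ∀ n < N, ∀ t : ℝ≥0, n ≤ t → t ≤ n + 1 → ∀ ω, X t ω = val (C n ω) + D n t ω := by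
    intro n hn t h1 h2 ω
    have h3 : ∑ k ∈ Finset.range N, D k t ω = ∑ k ∈ Finset.range (n + 1), D k t ω := by
      refine (Finset.sum_subset (Finset.range_mono hn) fun k _ hk => hD0 k t ω ?_).symm
      refine h2.trans ?_
      have : n + 1 ≤ k := by simpa using hk
      exact_mod_cast this
    have h4 : ∑ k ∈ Finset.range n, D k t ω = val (C n ω) - val s₀ := by
      rw [Finset.sum_congr rfl fun k hk => hD1 k t ω ?_,
        Finset.sum_range_sub (fun k => val (C k ω)), hC0]
      refine le_trans ?_ h1
      exact_mod_cast Finset.mem_range.1 hk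
    simp only [X]
    rw [h3, Finset.sum_range_succ, h4]
    ring
  have hXN : ∀ t ≥ (N : ℝ≥0), ∀ ω, X t ω = val (C N ω) := by
    intro t ht ω
    simp only [X]
    rw [Finset.sum_congr rfl fun k hk => hD1 k t ω ?_,
      Finset.sum_range_sub (fun k => val (C k ω)), hC0]
    · ring
    · refine le_trans ?_ ht
      exact_mod_cast Finset.mem_range.1 hk
  refine ⟨ℱ, X, C, ?_, fun ω => ?_, hC0, fun n ω => ?_, fun n hn ω => ?_,
    fun n hn t h1 h2 ω => ?_, fun t ht ω => ?_, hinteg, fun n f => ?_⟩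
  · have h1 : X = (fun _ _ => val s₀) + ∑ n ∈ Finset.range N, D n := by
      ext t ω
      simp [X, Finset.sum_apply]
    rw [h1]
    exact (martingale_const ℱ P (val s₀)).add (Finset.sum_induction _
      (fun f => Martingale f ℱ P) (fun _ _ h h' => h.add h') (martingale_zero _ _ _)
      fun n _ => hterm n fun s => val (up s) - val (down s))
  · exact continuous_const.add (continuous_finsetSum _ fun n _ =>
      continuous_const.mul ((hVc n (C n ω) ω).sub continuous_const))
  · rw [hCs]
    split_ifs <;> simp
  · rcases hn.lt_or_eq with h | rfl
    · rw [hXD n h n le_rfl (by simp), hD0 n n ω le_rfl, add_zero]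
    · exact hXN _ le_rfl ω
  · rw [hXD n hn t h1 h2, hDV, uIcc_comm, ← segment_eq_uIcc]
    obtain ⟨h3, h4⟩ := hVb n (C n ω) t ω
    exact ⟨1 - V n (C n ω) t ω, V n (C n ω) t ω, by linarith, h3, by ring, by
      simp only [smul_eq_mul]; ring⟩
  · rw [hXN t ht, hXN N le_rfl]
  · have hM := hterm n fun s => f (up s) - f (down s)
    have h0 := (hM.setIntegral_eq (zero_le : (0 : ℝ≥0) ≤ n + 1) MeasurableSet.univ)
    simp only [Measure.restrict_univ] at h0
    have h1 : ∀ ω, f (C (n + 1) ω) =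
        (θ (C n ω) * f (up (C n ω)) + (1 - θ (C n ω)) * f (down (C n ω))) +
          (f (up (C n ω)) - f (down (C n ω))) * (V n (C n ω) (n + 1) ω - θ (C n ω)) := by
      intro ω
      rw [hCs]
      rcases hVe n (C n ω) ω with h | h <;> simp [h] <;> ring
    simp_rw [h1]
    rw [integral_add (hinteg n fun s => θ s * f (up s) + (1 - θ s) * f (down s))
      (hM.integrable (n + 1)), ← h0]
    simp [hV0 n _ 0 zero_le]

theorem measurable_iSup_of_continuous {ι Ω : Type*} [TopologicalSpace ι]
    [TopologicalSpace.SeparableSpace ι] {m : MeasurableSpace Ω} {F : ι → Ω → ℝ}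
    (hF : ∀ i, Measurable (F i)) (hc : ∀ ω, Continuous fun i => F i ω) :
    Measurable fun ω => ⨆ i, F i ω := by
  obtain ⟨D, hD, hDd⟩ := TopologicalSpace.exists_countable_dense ι
  have := hD.to_subtype
  have h : (fun ω => ⨆ i, F i ω) = fun ω => ⨆ i : D, F i ω := funext fun ω =>
    (hDd.ciSup' (hc ω)).symm
  rw [h]
  exact Measurable.iSup fun i => hF i

theorem measurable_iInf_of_continuous {ι Ω : Type*} [TopologicalSpace ι]
    [TopologicalSpace.SeparableSpace ι] {m : MeasurableSpace Ω} {F : ι → Ω → ℝ}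
    (hF : ∀ i, Measurable (F i)) (hc : ∀ ω, Continuous fun i => F i ω) :
    Measurable fun ω => ⨅ i, F i ω := by
  obtain ⟨D, hD, hDd⟩ := TopologicalSpace.exists_countable_dense ι
  have := hD.to_subtype
  have h : (fun ω => ⨅ i, F i ω) = fun ω => ⨅ i : D, F i ω := funext fun ω =>
    (hDd.ciInf' (hc ω)).symm
  rw [h]
  exact Measurable.iInf fun i => hF i

/-- There is a continuous martingale starting from `0` whose running maximum has `p`-th moment
larger than `c` times that of its running minimum, the latter being positive and finite. -/
def ExistsExtremalMartingale (p c : ℝ) : Prop :=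
  ∃ (Ω : Type) (m0 : MeasurableSpace Ω) (P : Measure Ω),
    IsProbabilityMeasure P ∧ P.IsComplete ∧
    ∃ (ℱ : Filtration ℝ≥0 m0) (X : ℝ≥0 → Ω → ℝ),
      Martingale X ℱ P ∧
      (∀ ω, Continuous fun t => X t ω) ∧
      (∀ᵐ ω ∂P, X 0 ω = 0) ∧
      (0 < ⨆ t : ℝ≥0,
        (∫ ω, (-(⨅ s : Set.Icc (0 : ℝ≥0) t, min (X s.1 ω) 0)) ^ p ∂P) ^ (1 / p)) ∧
      BddAbove (Set.range fun t : ℝ≥0 =>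
        (∫ ω, (-(⨅ s : Set.Icc (0 : ℝ≥0) t, min (X s.1 ω) 0)) ^ p ∂P) ^ (1 / p)) ∧
      (⨆ t : ℝ≥0,
          (∫ ω, (⨆ s : Set.Icc (0 : ℝ≥0) t, |X s.1 ω|) ^ p ∂P) ^ (1 / p))
        > c * ⨆ t : ℝ≥0,
            (∫ ω, (-(⨅ s : Set.Icc (0 : ℝ≥0) t, min (X s.1 ω) 0)) ^ p ∂P) ^ (1 / p)

/-- Comparison of the running maximum and of the running minimum of the martingale interpolating
a random walk on a set of states, through a superharmonic function `g` and a subharmonic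
function `h`. The states record lower bounds `-mrec` for the past and `Mrec` for the past
maximum; `rank` bounds the number of steps before absorption. -/
theorem exists_martingale_of_stateMachine {S : Type} (val : S → ℝ) (up down : S → S)
    (θ : S → ℝ) (hθ : ∀ s, θ s ∈ Icc (0 : ℝ) 1)
    (hval : ∀ s, θ s * val (up s) + (1 - θ s) * val (down s) = val s) (s₀ : S)
    (rank : S → ℕ) (hrank₀ : 0 < rank s₀) (hrank_up : ∀ s, rank (up s) ≤ rank s - 1)
    (hrank_down : ∀ s, rank (down s) ≤ rank s - 1)
    (mrec Mrec g h : S → ℝ) (hm₀ : ∀ s, 0 ≤ mrec s) (hM₀ : ∀ s, 0 ≤ Mrec s)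
    (hm : ∀ s, ∀ s' ∈ ({up s, down s} : Set S),
      mrec s ≤ mrec s' ∧ -val (up s) ≤ mrec s' ∧ -val (down s) ≤ mrec s')
    (hM : ∀ s, ∀ s' ∈ ({up s, down s} : Set S), Mrec s' ≤ max (Mrec s) |val s'|)
    (hMs₀ : Mrec s₀ = 0) (hs₀ : val s₀ = 0) (hdown₀ : val (down s₀) < 0) (hθ₀ : θ s₀ < 1)
    {p c : ℝ} (hp : 0 < p) (hp1 : p < 1) (hc : 0 ≤ c)
    (hmg : ∀ s, mrec s ^ p ≤ g s) (hg : ∀ s, θ s * g (up s) + (1 - θ s) * g (down s) ≤ g s)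
    (hh : ∀ s, h s ≤ θ s * h (up s) + (1 - θ s) * h (down s))
    (hhM : ∀ s, rank s = 0 → h s ≤ Mrec s ^ p) (hgh : c ^ p * g s₀ < h s₀) :
    ExistsExtremalMartingale p c := by
  classical
  obtain ⟨Ω, m0, P, hP, hPc, ℱ, X, C, hXM, hXc, hC0, hCs, hXC, hXu, hXN, hinteg, hstep⟩ :=
    exists_continuous_martingale_interpolation val up down θ hθ hval s₀ (rank s₀)
  refine ⟨Ω, m0, P, hP, hPc, ℱ, X, hXM, hXc, ae_of_all _ fun ω => ?_, ?_⟩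
  · have := hXC 0 (Nat.zero_le _) ω
    rw [hC0, hs₀] at this
    simpa using this
  set N := rank s₀ with hN
  have hXm : ∀ t, Measurable (X t) := fun t => ((hXM.1 t).mono (ℱ.le t)).measurable
  have hmem : ∀ n ω, C (n + 1) ω ∈ ({up (C n ω), down (C n ω)} : Set S) := fun n ω => by
    simpa using hCs n ω
  -- the running minimum
  have hmmono : ∀ ω, Monotone fun n => mrec (C n ω) := fun ω =>
    monotone_nat_of_le_succ fun n => (hm _ _ (hmem n ω)).1
  have hvm : ∀ n ω, -val (C n ω) ≤ mrec (C n ω) := by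
    intro n ω
    cases n with
    | zero => rw [hC0, hs₀, neg_zero]; exact hm₀ _
    | succ n =>
      obtain ⟨-, h1, h2⟩ := hm _ _ (hmem n ω)
      rcases hCs n ω with h3 | h3
      · rw [h3] at h1 ⊢; exact h1
      · rw [h3] at h2 ⊢; exact h2
  have hcases : ∀ t : ℝ≥0, (N : ℝ≥0) ≤ t ∨ ∃ n < N, (n : ℝ≥0) ≤ t ∧ t ≤ n + 1 := by
    intro t
    rcases le_or_gt (N : ℝ≥0) t with h1 | h1
    · exact Or.inl h1
    · have h2 := Nat.floor_le (zero_le : 0 ≤ t)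
      exact Or.inr ⟨⌊t⌋₊, by exact_mod_cast h2.trans_lt h1, h2, (Nat.lt_floor_add_one t).le⟩
  have hlow : ∀ t ω, -mrec (C N ω) ≤ X t ω := by
    intro t ω
    rcases hcases t with h1 | ⟨n, hn, h1, h2⟩
    · rw [hXN t h1, hXC N le_rfl]
      linarith [hvm N ω]
    · obtain ⟨-, h3, h4⟩ := hm _ _ (hmem n ω)
      have h5 : mrec (C (n + 1) ω) ≤ mrec (C N ω) := hmmono ω hn
      exact le_trans (le_inf (by linarith) (by linarith)) (hXu n hn t h1 h2 ω).1
  let K : Ω → ℝ := fun ω => |val (C N ω)| +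
    ∑ n ∈ Finset.range N, (|val (up (C n ω))| + |val (down (C n ω))|)
  have hKi : Integrable K P := (hinteg N fun s => |val s|).add
    (integrable_finsetSum _ fun n _ => hinteg n fun s => |val (up s)| + |val (down s)|)
  have hK0 : ∀ ω, 0 ≤ K ω := fun ω => by positivity
  have hXK : ∀ t ω, |X t ω| ≤ K ω := by
    intro t ω
    rcases hcases t with h1 | ⟨n, hn, h1, h2⟩
    · rw [hXN t h1, hXC N le_rfl]
      exact le_add_of_nonneg_right (by positivity)
    · have h3 := Finset.single_le_sum
        (f := fun n => |val (up (C n ω))| + |val (down (C n ω))|)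
        (fun _ _ => by positivity) (Finset.mem_range.2 hn)
      have h4 := hXu n hn t h1 h2 ω
      have h5 : |X t ω| ≤ |val (up (C n ω))| + |val (down (C n ω))| := by
        refine abs_le.2 ⟨le_trans (le_inf ?_ ?_) h4.1, h4.2.trans (sup_le ?_ ?_)⟩ <;>
          linarith [neg_abs_le (val (up (C n ω))), neg_abs_le (val (down (C n ω))),
            le_abs_self (val (up (C n ω))), le_abs_self (val (down (C n ω))),
            abs_nonneg (val (up (C n ω))), abs_nonneg (val (down (C n ω)))]
      simp only [K]
      linarith [abs_nonneg (val (C N ω))]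
  have hrpow : ∀ x : ℝ, 0 ≤ x → x ^ p ≤ 1 + x := by
    intro x hx
    rcases le_total x 1 with h1 | h1
    · linarith [Real.rpow_le_one hx h1 hp.le]
    · have := Real.rpow_le_rpow_of_exponent_le h1 hp1.le
      rw [Real.rpow_one] at this
      linarith
  let L : ℝ≥0 → Ω → ℝ := fun t ω => -(⨅ s : Set.Icc (0 : ℝ≥0) t, min (X s.1 ω) 0)
  let U : ℝ≥0 → Ω → ℝ := fun t ω => ⨆ s : Set.Icc (0 : ℝ≥0) t, |X s.1 ω|
  have hne : ∀ t : ℝ≥0, Nonempty (Set.Icc (0 : ℝ≥0) t) := fun t => ⟨⟨0, by simp⟩⟩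
  have hLm : ∀ t, Measurable (L t) := fun t =>
    (measurable_iInf_of_continuous (fun s : Set.Icc (0 : ℝ≥0) t => (hXm s).min measurable_const)
      fun ω => ((hXc ω).comp continuous_subtype_val).min continuous_const).neg
  have hUm : ∀ t, Measurable (U t) := fun t =>
    measurable_iSup_of_continuous (fun s : Set.Icc (0 : ℝ≥0) t => (hXm s).abs)
      fun ω => ((hXc ω).comp continuous_subtype_val).abs
  have hUbdd : ∀ t ω, BddAbove (range fun s : Set.Icc (0 : ℝ≥0) t => |X s.1 ω|) := fun t ω =>
    ⟨K ω, by rintro _ ⟨s, rfl⟩; exact hXK _ _⟩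
  have hLbdd : ∀ t ω, BddBelow (range fun s : Set.Icc (0 : ℝ≥0) t => min (X s.1 ω) 0) :=
    fun t ω => ⟨-mrec (C N ω), by
      rintro _ ⟨s, rfl⟩; exact le_min (hlow _ _) (by linarith [hm₀ (C N ω)])⟩
  have hU0 : ∀ t ω, 0 ≤ U t ω := fun t ω => Real.iSup_nonneg fun _ => abs_nonneg _
  have hUK : ∀ t ω, U t ω ≤ K ω := fun t ω => ciSup_le fun s => hXK _ _
  have hLX : ∀ t ω, max (-X t ω) 0 ≤ L t ω := fun t ω => by
    have := ciInf_le (hLbdd t ω) ⟨t, by simp⟩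
    have h2 : max (-X t ω) 0 = -min (X t ω) 0 := by rw [← max_neg_neg, neg_zero]
    rw [h2]
    exact neg_le_neg this
  have hL0 : ∀ t ω, 0 ≤ L t ω := fun t ω => (le_max_right _ _).trans (hLX t ω)
  have hLrec : ∀ t ω, L t ω ≤ mrec (C N ω) := fun t ω =>
    neg_le.1 (le_ciInf fun s => le_min (hlow _ _) (by linarith [hm₀ (C N ω)]))
  have hLpi : ∀ t, Integrable (fun ω => L t ω ^ p) P := fun t =>
    Integrable.mono' (hinteg N fun s => mrec s ^ p)
      ((hLm t).pow_const p).aestronglyMeasurable (ae_of_all _ fun ω => by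
        rw [Real.norm_of_nonneg (Real.rpow_nonneg (hL0 t ω) p)]
        exact Real.rpow_le_rpow (hL0 t ω) (hLrec t ω) hp.le)
  have hUpi : ∀ t, Integrable (fun ω => U t ω ^ p) P := fun t =>
    Integrable.mono' ((integrable_const (1 : ℝ)).add hKi)
      ((hUm t).pow_const p).aestronglyMeasurable (ae_of_all _ fun ω => by
        rw [Real.norm_of_nonneg (Real.rpow_nonneg (hU0 t ω) p)]
        exact (hrpow _ (hU0 t ω)).trans (by simpa using hUK t ω))
  -- expectations along the chain
  have hgC : ∀ n, ∫ ω, g (C n ω) ∂P ≤ g s₀ := by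
    intro n
    induction n with
    | zero => simp [hC0]
    | succ n ih =>
      rw [hstep]
      exact (integral_mono (hinteg n fun s => θ s * g (up s) + (1 - θ s) * g (down s))
        (hinteg n g) fun ω => hg _).trans ih
  have hhC : ∀ n, h s₀ ≤ ∫ ω, h (C n ω) ∂P := by
    intro n
    induction n with
    | zero => simp [hC0]
    | succ n ih =>
      rw [hstep]
      exact ih.trans (integral_mono (hinteg n h)
        (hinteg n fun s => θ s * h (up s) + (1 - θ s) * h (down s)) fun ω => hh _)
  have hLg : ∀ t, ∫ ω, L t ω ^ p ∂P ≤ g s₀ := fun t =>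
    (integral_mono (hLpi t) (hinteg N g) fun ω =>
      (Real.rpow_le_rpow (hL0 t ω) (hLrec t ω) hp.le).trans (hmg _)).trans (hgC N)
  have hLint0 : ∀ t, 0 ≤ ∫ ω, L t ω ^ p ∂P := fun t =>
    integral_nonneg fun ω => Real.rpow_nonneg (hL0 t ω) p
  have hg0 : 0 ≤ g s₀ := (hLint0 0).trans (hLg 0)
  have hip : 0 ≤ 1 / p := by positivity
  have hLroot : ∀ t, (∫ ω, L t ω ^ p ∂P) ^ (1 / p) ≤ g s₀ ^ (1 / p) := fun t =>
    Real.rpow_le_rpow (hLint0 t) (hLg t) hip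
  have hLrange : BddAbove (range fun t => (∫ ω, L t ω ^ p ∂P) ^ (1 / p)) :=
    ⟨_, by rintro _ ⟨t, rfl⟩; exact hLroot t⟩
  refine ⟨?_, hLrange, ?_⟩
  · refine lt_of_lt_of_le ?_ (le_ciSup hLrange 1)
    refine Real.rpow_pos_of_pos ?_ _
    let F : S → ℝ := fun s => max (-val s) 0 ^ p
    have h1 : ∫ ω, F (C 1 ω) ∂P ≤ ∫ ω, L 1 ω ^ p ∂P := by
      refine integral_mono (hinteg 1 F) (hLpi 1) fun ω => ?_
      refine Real.rpow_le_rpow (le_max_right _ _) ?_ hp.le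
      have := hXC 1 hrank₀ ω
      rw [← this]
      simpa using hLX 1 ω
    refine lt_of_lt_of_le ?_ h1
    rw [hstep 0 F]
    simp only [hC0]
    rw [integral_const]
    simp only [probReal_univ, one_smul]
    have h2 : 0 < F (down s₀) := Real.rpow_pos_of_pos (lt_max_of_lt_left (by linarith)) p
    have h3 : 0 ≤ F (up s₀) := Real.rpow_nonneg (le_max_right _ _) p
    have h4 := mul_pos (sub_pos.2 hθ₀) h2
    have h5 := mul_nonneg (hθ s₀).1 h3
    linarith
  · have hrankC : ∀ n ω, rank (C n ω) ≤ N - n := by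
      intro n ω
      induction n with
      | zero => rw [hC0]; exact le_rfl
      | succ n ih =>
        have h1 : rank (C (n + 1) ω) ≤ rank (C n ω) - 1 := by
          rcases hCs n ω with h1 | h1 <;> rw [h1]
          · exact hrank_up _
          · exact hrank_down _
        omega
    have hMU : ∀ n ≤ N, ∀ ω, Mrec (C n ω) ≤ U N ω := by
      intro n
      induction n with
      | zero => intro _ ω; rw [hC0, hMs₀]; exact hU0 _ _
      | succ n ih =>
        intro hn ω
        refine (hM _ _ (hmem n ω)).trans (max_le (ih (by omega) ω) ?_)
        rw [← hXC (n + 1) hn ω]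
        exact le_ciSup (hUbdd N ω) ⟨((n + 1 : ℕ) : ℝ≥0), zero_le, by exact_mod_cast hn⟩
    have hUint0 : ∀ t, 0 ≤ ∫ ω, U t ω ^ p ∂P := fun t =>
      integral_nonneg fun ω => Real.rpow_nonneg (hU0 t ω) p
    have h1 : h s₀ ≤ ∫ ω, U N ω ^ p ∂P := by
      refine (hhC N).trans (integral_mono (hinteg N h) (hUpi N) fun ω => ?_)
      refine (hhM _ (by have := hrankC N ω; omega)).trans ?_
      exact Real.rpow_le_rpow (hM₀ _) (hMU N le_rfl ω) hp.le
    have hUrange : BddAbove (range fun t => (∫ ω, U t ω ^ p ∂P) ^ (1 / p)) := by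
      refine ⟨(∫ ω, (1 + K ω) ∂P) ^ (1 / p), ?_⟩
      rintro _ ⟨t, rfl⟩
      refine Real.rpow_le_rpow (hUint0 t) ?_ hip
      refine integral_mono (hUpi t) ((integrable_const (1 : ℝ)).add hKi) fun ω => ?_
      exact (hrpow _ (hU0 t ω)).trans (by simpa using hUK t ω)
    have h2 : (⨆ t, (∫ ω, L t ω ^ p ∂P) ^ (1 / p)) ≤ g s₀ ^ (1 / p) := ciSup_le hLroot
    have h3 : h s₀ ^ (1 / p) ≤ ⨆ t, (∫ ω, U t ω ^ p ∂P) ^ (1 / p) := by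
      have hh0 : 0 ≤ h s₀ := (mul_nonneg (Real.rpow_nonneg hc p) hg0).trans hgh.le
      exact (Real.rpow_le_rpow hh0 h1 hip).trans (le_ciSup hUrange (N : ℝ≥0))
    refine lt_of_lt_of_le (lt_of_le_of_lt (mul_le_mul_of_nonneg_left h2 hc) ?_) h3
    have h4 : c * g s₀ ^ (1 / p) = (c ^ p * g s₀) ^ (1 / p) := by
      rw [Real.mul_rpow (Real.rpow_nonneg hc p) hg0, ← Real.rpow_mul hc,
        mul_one_div_cancel hp.ne', Real.rpow_one]
    rw [h4]
    exact Real.rpow_lt_rpow (mul_nonneg (Real.rpow_nonneg hc p) hg0) hgh (by positivity)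

/-- States of a random walk: it leaves `start` for the absorbing state `one` or for `low 0`; from
`low k` it sinks to `low (k + 1)` or leaves for `high k 0`; from `high k j` it climbs to
`high k (j + 1)` or falls to the absorbing state `fallen k j`. -/
inductive LadderState
  | start
  | one
  | low (k : ℕ)
  | high (k j : ℕ)
  | fallen (k j : ℕ)

namespace LadderState

/-- The upward transition, with absorption in `low N` and in `high k m`. -/
def up (N m : ℕ) : LadderState → LadderState
  | start => one
  | one => one
  | low k => if k < N then high k 0 else low k
  | high k j => if j < m then high k (j + 1) else high k j
  | fallen k j => fallen k j

/-- The downward transition, with absorption in `low N` and in `high k m`. -/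
def down (N m : ℕ) : LadderState → LadderState
  | start => low 0
  | one => one
  | low k => if k < N then low (k + 1) else low k
  | high k j => if j < m then fallen k j else high k j
  | fallen k j => fallen k j

/-- A bound for the number of steps before absorption. -/
def rank (N m : ℕ) : LadderState → ℕ
  | start => N + m + 2
  | one => 0
  | low k => if k < N then N - k + m + 1 else 0
  | high _ j => m - j
  | fallen _ _ => 0

/-- The position of the walk. -/
def val (r : ℝ) (s : ℕ → ℝ) : LadderState → ℝ
  | start => 0
  | one => 1
  | low k => -r ^ k
  | high k j => s j * r ^ k
  | fallen k _ => -r ^ k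

/-- The probability of the upward transition. -/
noncomputable def prob (u : ℝ) (s : ℕ → ℝ) : LadderState → ℝ
  | start => 1 / 2
  | one => 1 / 2
  | low _ => u
  | high _ j => (1 + s j) / (1 + s (j + 1))
  | fallen _ _ => 1 / 2

/-- A bound for minus the running minimum. -/
def minRec (r : ℝ) : LadderState → ℝ
  | start => 0
  | one => 1
  | low k => r ^ k
  | high k _ => r ^ (k + 1)
  | fallen k _ => r ^ (k + 1)

/-- A lower bound for the running maximum. -/
def maxRec (r : ℝ) (e : ℕ → ℝ) : LadderState → ℝ
  | start => 0
  | one => 0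
  | low k => r ^ k
  | high k j => e j * r ^ k
  | fallen k j => e j * r ^ k

/-- A superharmonic majorant of the `p`-th power of `minRec`, where `R` is the `p`-th power of the
ratio `r`. -/
noncomputable def superFun (R u : ℝ) (N : ℕ) : LadderState → ℝ
  | start => (2 + N * u * R) / 2
  | one => 1
  | low k => R ^ k * (1 + (N - k : ℕ) * u * R)
  | high k _ => R ^ (k + 1)
  | fallen k _ => R ^ (k + 1)

/-- A subharmonic function which on absorbing states is at most the `p`-th power of `maxRec`, where
`R` is the `p`-th power of the ratio `r`. -/
noncomputable def subFun (p R u : ℝ) (N : ℕ) (e w : ℕ → ℝ) : LadderState → ℝ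
  | start => N * u * w 0 / 2
  | one => 0
  | low k => R ^ k * ((N - k : ℕ) * u * w 0)
  | high k j => R ^ k * w j
  | fallen k j => R ^ k * e j ^ p

end LadderState

open LadderState in
theorem existsExtremalMartingale_of_ladder {p c : ℝ} (hp : 0 < p) (hp1 : p < 1) (hc : 0 ≤ c)
    {r : ℝ} (hr : 1 < r) {a : ℝ} (ha : a = (r - r ^ p) / (r ^ p - 1)) (s e : ℕ → ℝ)
    (he : Monotone e) (he₀ : e 0 = max 1 a) (hs₀ : s 0 = a) (hse : ∀ j, s (j + 1) = e (j + 1))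
    (m : ℕ) (hw : c ^ p * r ^ p <
      e 0 ^ p + (1 + a) * ∑ j ∈ Finset.range m, (e (j + 1) ^ p - e j ^ p) / (1 + e (j + 1))) :
    ExistsExtremalMartingale p c := by
  have hr0 : 0 < r := one_pos.trans hr
  set R := r ^ p with hR
  have hR1 : 1 < R := Real.one_lt_rpow hr hp
  have hR0 : 0 < R := one_pos.trans hR1
  have hRr : R < r := by
    simpa using Real.rpow_lt_rpow_of_exponent_lt hr hp1
  have hpow : ∀ k : ℕ, (r ^ k) ^ p = R ^ k := fun k => by
    rw [hR, ← Real.rpow_natCast, ← Real.rpow_natCast, ← Real.rpow_mul hr0.le,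
      ← Real.rpow_mul hr0.le, mul_comm]
  set u := 1 - 1 / R with hu
  have hu0 : 0 < u := by rw [hu, sub_pos, div_lt_one hR0]; exact hR1
  have hu1 : u ≤ 1 := by rw [hu]; linarith [one_div_pos.2 hR0]
  have huR : (1 - u) * R = 1 := by rw [hu]; field_simp; ring
  have ha0 : 0 < a := by rw [ha]; exact div_pos (by linarith) (by linarith)
  have hua : u * (a + r) = r - 1 := by
    have : R - 1 ≠ 0 := by linarith
    rw [hu, ha]; field_simp; ring
  have he1 : ∀ j, 1 ≤ e j := fun j =>
    (he₀ ▸ le_max_left _ _ : 1 ≤ e 0).trans (he (Nat.zero_le j))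
  have hsle : ∀ j, s j ≤ e j := fun j => by
    cases j with
    | zero => rw [hs₀, he₀]; exact le_max_right _ _
    | succ j => exact (hse j).le
  have hs0 : ∀ j, 0 < s j := fun j => by
    cases j with
    | zero => rw [hs₀]; exact ha0
    | succ j => rw [hse]; linarith [he1 (j + 1)]
  have hsmono : ∀ j, s j ≤ s (j + 1) := fun j =>
    (hsle j).trans ((he (Nat.le_succ j)).trans (hse j).ge)
  have hθ0 : ∀ j, 0 ≤ (1 + s j) / (1 + s (j + 1)) := fun j =>
    div_nonneg (by linarith [hs0 j]) (by linarith [hs0 (j + 1)])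
  have hθ1 : ∀ j, (1 + s j) / (1 + s (j + 1)) ≤ 1 := fun j =>
    div_le_one_of_le₀ (by linarith [hsmono j]) (by linarith [hs0 (j + 1)])
  have hθs : ∀ j, (1 + s j) / (1 + s (j + 1)) * (1 + s (j + 1)) = 1 + s j := fun j =>
    div_mul_cancel₀ _ (by linarith [hs0 (j + 1)])
  let d : ℕ → ℝ := fun j => (e (j + 1) ^ p - e j ^ p) / (1 + e (j + 1))
  let w : ℕ → ℝ := fun j => e j ^ p + (1 + s j) * ∑ i ∈ Finset.Ico j m, d i
  have hwm : ∀ j, m ≤ j → w j = e j ^ p := fun j hj => by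
    simp [w, Finset.Ico_eq_empty_of_le hj]
  have hwstep : ∀ j < m, w j = (1 + s j) / (1 + s (j + 1)) * w (j + 1) +
      (1 - (1 + s j) / (1 + s (j + 1))) * e j ^ p := by
    intro j hj
    have h1 : 1 + e (j + 1) ≠ 0 := by linarith [he1 (j + 1)]
    simp only [w, d]
    rw [Finset.sum_eq_sum_Ico_succ_bot hj, hse]
    field_simp
    ring
  have hw0 : c ^ p * R < w 0 := by
    simpa only [w, d, hs₀, Finset.range_eq_Ico] using hw
  have hk : ∀ k : ℕ, 0 < r ^ k := fun k => pow_pos hr0 k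
  have hkk : ∀ k : ℕ, r ^ k ≤ r ^ (k + 1) := fun k => pow_le_pow_right₀ hr.le (Nat.le_succ k)
  obtain ⟨N, hN⟩ := exists_nat_gt (2 * c ^ p / (u * (w 0 - c ^ p * R)))
  have hN' : c ^ p * (2 + N * u * R) < N * u * w 0 := by
    rw [div_lt_iff₀ (mul_pos hu0 (sub_pos.2 hw0))] at hN
    linarith
  have hsubN : ∀ k < N, ((N - k : ℕ) : ℝ) = (N - (k + 1) : ℕ) + 1 := fun k hk => by
    exact_mod_cast (show N - k = N - (k + 1) + 1 by omega)
  refine exists_martingale_of_stateMachine (val r s) (up N m) (down N m) (prob u s) ?_ ?_ start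
    (rank N m) ?_ ?_ ?_ (minRec r) (maxRec r e) (superFun R u N) (subFun p R u N e w) ?_ ?_ ?_ ?_
    rfl rfl ?_ ?_ hp hp1 hc ?_ ?_ ?_ ?_ ?_
  · rintro (_ | _ | k | ⟨k, j⟩ | ⟨k, j⟩) <;> simp only [prob, mem_Icc]
    · norm_num
    · norm_num
    · exact ⟨hu0.le, hu1⟩
    · exact ⟨hθ0 j, hθ1 j⟩
    · norm_num
  · rintro (_ | _ | k | ⟨k, j⟩ | ⟨k, j⟩) <;> simp only [prob, up, down]
    · norm_num [val]
    · norm_num [val]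
    · split_ifs
      · simp only [val, hs₀, pow_succ]
        linear_combination r ^ k * hua
      · ring
    · split_ifs
      · simp only [val]
        linear_combination r ^ k * hθs j
      · ring
    · ring
  · simp [rank]
  · rintro (_ | _ | k | ⟨k, j⟩ | ⟨k, j⟩) <;> simp only [up] <;> (try split_ifs) <;>
      simp only [rank] <;> (try split_ifs) <;> omega
  · rintro (_ | _ | k | ⟨k, j⟩ | ⟨k, j⟩) <;> simp only [down] <;> (try split_ifs) <;>
      simp only [rank] <;> (try split_ifs) <;> omega
  · rintro (_ | _ | k | ⟨k, j⟩ | ⟨k, j⟩) <;> simp only [minRec] <;> positivity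
  · rintro (_ | _ | k | ⟨k, j⟩ | ⟨k, j⟩) <;> simp only [maxRec]
    · exact le_rfl
    · exact le_rfl
    · exact (hk k).le
    · exact mul_nonneg (by linarith [he1 j]) (hk k).le
    · exact mul_nonneg (by linarith [he1 j]) (hk k).le
  · have hks : ∀ k j, 0 < s j * r ^ k := fun k j => mul_pos (hs0 j) (hk k)
    rintro (_ | _ | k | ⟨k, j⟩ | ⟨k, j⟩) x hx <;> simp only [up, down] at hx ⊢
    · rcases hx with rfl | rfl <;> simp [val, minRec]
    · rcases hx with rfl | rfl <;> simp [val, minRec]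
    · split_ifs at hx ⊢ <;> rcases hx with rfl | rfl <;> simp only [val, minRec] <;>
        refine ⟨?_, ?_, ?_⟩ <;> linarith [hk k, hkk k, hk (k + 1), hks k 0]
    · split_ifs at hx ⊢ <;> rcases hx with rfl | rfl <;> simp only [val, minRec] <;>
        refine ⟨?_, ?_, ?_⟩ <;> linarith [hk k, hkk k, hk (k + 1), hks k j, hks k (j + 1)]
    · rcases hx with rfl | rfl <;> simp only [val, minRec] <;>
        refine ⟨?_, ?_, ?_⟩ <;> linarith [hk k, hkk k, hk (k + 1)]
  · rintro (_ | _ | k | ⟨k, j⟩ | ⟨k, j⟩) x hx <;> simp only [up, down] at hx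
    · rcases hx with rfl | rfl <;> simp [val, maxRec]
    · rcases hx with rfl | rfl <;> simp [val, maxRec]
    · split_ifs at hx <;> rcases hx with rfl | rfl <;> simp only [val, maxRec]
      · rw [he₀, hs₀, max_mul_of_nonneg _ _ (hk k).le, one_mul]
        exact max_le_max le_rfl (le_abs_self _)
      · rw [abs_neg, abs_of_pos (hk _)]; exact le_max_right _ _
      · exact le_max_left _ _
      · exact le_max_left _ _
    · split_ifs at hx <;> rcases hx with rfl | rfl <;> simp only [val, maxRec]
      · rw [hse]; exact (le_abs_self _).trans (le_max_right _ _)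
      · exact le_max_left _ _
      · exact le_max_left _ _
      · exact le_max_left _ _
    · rcases hx with rfl | rfl <;> exact le_max_left _ _
  · simp [down, val]
  · simp only [prob]; norm_num
  · rintro (_ | _ | k | ⟨k, j⟩ | ⟨k, j⟩) <;> simp only [minRec, superFun]
    · rw [Real.zero_rpow hp.ne']; positivity
    · simp
    · rw [hpow]
      exact le_mul_of_one_le_right (by positivity) (le_add_of_nonneg_right (by positivity))
    · rw [hpow]
    · rw [hpow]
  · rintro (_ | _ | k | ⟨k, j⟩ | ⟨k, j⟩) <;> simp only [prob, up, down]
    · simp only [superFun]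
      norm_num
      linarith
    · simp only [superFun]; norm_num
    · split_ifs with h
      · simp only [superFun]
        rw [hsubN k h, pow_succ]
        refine le_of_eq ?_
        linear_combination (R ^ k * (1 + (N - (k + 1) : ℕ) * u * R)) * huR
      · exact le_of_eq (by ring)
    · split_ifs with h
      · simp only [superFun]; exact le_of_eq (by ring)
      · exact le_of_eq (by ring)
    · exact le_of_eq (by ring)
  · rintro (_ | _ | k | ⟨k, j⟩ | ⟨k, j⟩) <;> simp only [prob, up, down]
    · simp only [subFun]
      norm_num
      linarith
    · simp only [subFun]; norm_num
    · split_ifs with h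
      · simp only [subFun]
        rw [hsubN k h, pow_succ]
        refine le_of_eq ?_
        linear_combination -(R ^ k * ((N - (k + 1) : ℕ) * u * w 0)) * huR
      · exact le_of_eq (by ring)
    · split_ifs with h
      · simp only [subFun]
        rw [hwstep j h]
        exact le_of_eq (by ring)
      · exact le_of_eq (by ring)
    · exact le_of_eq (by ring)
  · have hek : ∀ k j, (e j * r ^ k) ^ p = R ^ k * e j ^ p := fun k j => by
      rw [Real.mul_rpow (by linarith [he1 j]) (hk k).le, hpow, mul_comm]
    rintro (_ | _ | k | ⟨k, j⟩ | ⟨k, j⟩) h <;> simp only [rank] at h <;>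
      simp only [subFun, maxRec]
    · omega
    · rw [Real.zero_rpow hp.ne']
    · split_ifs at h with h'
      · have h1 : N - k = 0 := by omega
        rw [h1, hpow]
        simp only [Nat.cast_zero, zero_mul, mul_zero]
        positivity
    · rw [hek, hwm j (by omega)]
    · rw [hek]
  · simp only [superFun, subFun]
    linarith

theorem continuousOn_rpow_div_add_one (p : ℝ) :
    ContinuousOn (fun s : ℝ => s ^ (p - 1) / (s + 1)) (Ioi 0) :=
  ContinuousOn.div (fun s hs => (Real.continuousAt_rpow_const s _
    (Or.inl (ne_of_gt hs))).continuousWithinAt) (by fun_prop)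
    fun s hs => by have : (0 : ℝ) < s := hs; positivity

theorem intervalIntegrable_rpow_div_add_one (p : ℝ) {x y : ℝ} (hx : 0 < x) (hy : 0 < y) :
    IntervalIntegrable (fun s : ℝ => s ^ (p - 1) / (s + 1)) volume x y :=
  ((continuousOn_rpow_div_add_one p).mono fun _ hs =>
    (lt_min hx hy).trans_le hs.1).intervalIntegrable

theorem intervalIntegrable_rpow_of_pos (p : ℝ) {x y : ℝ} (hx : 0 < x) (hy : 0 < y) :
    IntervalIntegrable (fun s : ℝ => s ^ p) volume x y :=
  intervalIntegral.intervalIntegrable_rpow (Or.inr (notMem_uIcc_of_lt hx hy))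

theorem integrableOn_Ioi_rpow_div_add_one {p : ℝ} (hp1 : p < 1) {x : ℝ} (hx : 0 < x) :
    IntegrableOn (fun s : ℝ => s ^ (p - 1) / (s + 1)) (Ioi x) := by
  refine Integrable.mono' (integrableOn_Ioi_rpow_of_lt (by linarith : p - 1 - 1 < -1) hx)
    (((continuousOn_rpow_div_add_one p).mono fun s hs => hx.trans hs).aestronglyMeasurable
      measurableSet_Ioi) ?_
  refine (ae_restrict_iff' measurableSet_Ioi).2 (ae_of_all _ fun s hs => ?_)
  have hs0 : 0 < s := hx.trans hs
  rw [Real.norm_of_nonneg (by positivity), Real.rpow_sub_one hs0.ne' (p - 1)]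
  gcongr
  linarith

theorem rpow_sub_rpow_eq_integral {p x y : ℝ} (hp : 0 < p) (hx : 0 < x) (hy : 0 < y) :
    y ^ p - x ^ p = ∫ s in x..y, p * s ^ (p - 1) := by
  rw [intervalIntegral.integral_const_mul, integral_rpow (Or.inr
    ⟨by linarith, notMem_uIcc_of_lt hx hy⟩), sub_add_cancel]
  field_simp

theorem mul_integral_le_div_one_add {p r x : ℝ} (hp : 0 < p) (hr : 1 < r) (hx : 0 < x) :
    p / r * ∫ s in x..(x * r), s ^ (p - 1) / (s + 1) ≤
      ((x * r) ^ p - x ^ p) / (1 + x * r) := by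
  have hr0 : 0 < r := one_pos.trans hr
  have hxr : x ≤ x * r := le_mul_of_one_le_right hx.le hr.le
  have hxr0 : 0 < x * r := mul_pos hx hr0
  rw [rpow_sub_rpow_eq_integral hp hx hxr0, ← intervalIntegral.integral_div,
    ← intervalIntegral.integral_const_mul]
  refine intervalIntegral.integral_mono_on hxr
    ((intervalIntegrable_rpow_div_add_one p hx hxr0).const_mul _)
    (((intervalIntegrable_rpow_of_pos (p - 1) hx hxr0).const_mul _).div_const _) fun s hs => ?_
  have hs0 : 0 < s := hx.trans_le hs.1
  have h1 : 1 + x * r ≤ r * (s + 1) := by nlinarith [hs.1]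
  rw [div_mul_div_comm]
  gcongr

theorem rpow_add_integral_Ioi_mono {p x y : ℝ} (hp : 0 < p) (hp1 : p < 1) (hx0 : 0 < x)
    (hx : 1 / p - 1 ≤ x) (hxy : x ≤ y) :
    x ^ p + ∫ s in Ioi x, s ^ (p - 1) / (s + 1) ≤ y ^ p + ∫ s in Ioi y, s ^ (p - 1) / (s + 1) := by
  have hy0 : 0 < y := hx0.trans_le hxy
  rw [← intervalIntegral.integral_interval_add_Ioi (integrableOn_Ioi_rpow_div_add_one hp1 hx0)
    (integrableOn_Ioi_rpow_div_add_one hp1 hy0)]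
  have h1 : ∫ s in x..y, s ^ (p - 1) / (s + 1) ≤ ∫ s in x..y, p * s ^ (p - 1) := by
    refine intervalIntegral.integral_mono_on hxy (intervalIntegrable_rpow_div_add_one p hx0 hy0)
      ((intervalIntegrable_rpow_of_pos (p - 1) hx0 hy0).const_mul _) fun s hs => ?_
    have hs0 : 0 < s := hx0.trans_le hs.1
    have h2 : 1 / p ≤ s + 1 := by linarith [hs.1]
    rw [div_le_iff₀ hp] at h2
    rw [div_le_iff₀ (by positivity)]
    have h3 : 0 < s ^ (p - 1) := by positivity
    nlinarith
  rw [← rpow_sub_rpow_eq_integral hp hx0 hy0] at h1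
  linarith

theorem existsExtremalMartingale_of_lt {p c : ℝ} (hp : 0 < p) (hp1 : p < 1) (hc : 0 ≤ c)
    {x : ℝ} (hx : x = max 1 (1 / p - 1))
    (h : c ^ p < x ^ p + ∫ s in Ioi x, s ^ (p - 1) / (s + 1)) :
    ExistsExtremalMartingale p c := by
  have hx1 : 1 ≤ x := hx ▸ le_max_left _ _
  have hx0 : 0 < x := one_pos.trans_le hx1
  obtain ⟨r, hr, hcr⟩ : ∃ r : ℝ, 1 < r ∧
      c ^ p * (r ^ p * r) < x ^ p + ∫ s in Ioi x, s ^ (p - 1) / (s + 1) := by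
    have h1 : ContinuousAt (fun r : ℝ => c ^ p * (r ^ p * r)) 1 :=
      ((Real.continuousAt_rpow_const 1 p (Or.inl one_ne_zero)).mul continuousAt_id).const_mul _
    have h2 := h1.eventually_lt_const (show c ^ p * ((1 : ℝ) ^ p * 1) < _ by simpa using h)
    obtain ⟨r, h3, h4⟩ := ((h2.filter_mono nhdsWithin_le_nhds).and
      (self_mem_nhdsWithin : Ioi (1 : ℝ) ∈ 𝓝[>] 1)).exists
    exact ⟨r, h4, h3⟩
  have hr0 : 0 < r := one_pos.trans hr
  have hR1 : 1 < r ^ p := Real.one_lt_rpow hr hp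
  set a := (r - r ^ p) / (r ^ p - 1) with ha
  have ha1 : 1 / p ≤ 1 + a := by
    have h1 : 1 + a = (r - 1) / (r ^ p - 1) := by
      have : r ^ p - 1 ≠ 0 := by linarith
      rw [ha]; field_simp; ring
    have h2 := rpow_one_add_le_one_add_mul_self (s := r - 1) (by linarith) hp.le hp1.le
    rw [add_sub_cancel] at h2
    rw [h1, div_le_div_iff₀ hp (by linarith)]
    linarith
  set b := max 1 a with hb
  have hxb : x ≤ b := hx ▸ max_le_max le_rfl (by linarith)
  have hb1 : 1 ≤ b := le_max_left _ _
  have hb0 : 0 < b := one_pos.trans_le hb1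
  have hφ := rpow_add_integral_Ioi_mono hp hp1 hx0 (hx ▸ le_max_right _ _) hxb
  have hbr : ∀ j : ℕ, 0 < b * r ^ j := fun j => by positivity
  have hlim : Tendsto (fun J : ℕ => b ^ p + 1 / r * ∫ s in b..(b * r ^ J), s ^ (p - 1) / (s + 1))
      atTop (𝓝 (b ^ p + 1 / r * ∫ s in Ioi b, s ^ (p - 1) / (s + 1))) :=
    ((intervalIntegral_tendsto_integral_Ioi b (integrableOn_Ioi_rpow_div_add_one hp1 hb0)
      ((tendsto_pow_atTop_atTop_of_one_lt hr).const_mul_atTop hb0)).const_mul _).const_add _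
  have hlt : c ^ p * r ^ p < b ^ p + 1 / r * ∫ s in Ioi b, s ^ (p - 1) / (s + 1) := by
    have h1 : c ^ p * r ^ p * r < b ^ p + ∫ s in Ioi b, s ^ (p - 1) / (s + 1) := by
      rw [mul_assoc]; exact hcr.trans_le hφ
    rw [← lt_div_iff₀ hr0, add_div] at h1
    have h2 : b ^ p / r ≤ b ^ p := div_le_self (by positivity) hr.le
    rw [one_div_mul_eq_div]
    linarith
  obtain ⟨J, hJ⟩ := (hlim.eventually_const_lt hlt).exists
  let e : ℕ → ℝ := fun j => Nat.casesOn j b fun i => b * r ^ i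
  let s : ℕ → ℝ := fun j => Nat.casesOn j a fun i => b * r ^ i
  refine existsExtremalMartingale_of_ladder hp hp1 hc hr ha s e ?_ rfl rfl (fun _ => rfl) (J + 1)
    (hJ.trans_le ?_)
  · refine monotone_nat_of_le_succ fun j => ?_
    cases j with
    | zero => simp [e]
    | succ j =>
      exact mul_le_mul_of_nonneg_left (pow_le_pow_right₀ hr.le (Nat.le_succ j)) hb0.le
  · refine add_le_add le_rfl ?_
    rw [Finset.sum_range_succ']
    have h1 : p / r * ∫ s in b..(b * r ^ J), s ^ (p - 1) / (s + 1) ≤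
        ∑ j ∈ Finset.range J, (e (j + 1 + 1) ^ p - e (j + 1) ^ p) / (1 + e (j + 1 + 1)) := by
      have h2 := intervalIntegral.sum_integral_adjacent_intervals (μ := volume)
        (a := fun j => b * r ^ j) (n := J)
        fun k _ => intervalIntegrable_rpow_div_add_one p (hbr k) (hbr (k + 1))
      simp only [pow_zero, mul_one] at h2
      rw [← h2, Finset.mul_sum]
      refine Finset.sum_le_sum fun j _ => ?_
      have h3 := mul_integral_le_div_one_add hp hr (hbr j)
      rw [mul_assoc, ← pow_succ] at h3
      exact h3
    have h4 : 0 ≤ ∫ s in b..(b * r ^ J), s ^ (p - 1) / (s + 1) := by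
      refine intervalIntegral.integral_nonneg (le_mul_of_one_le_right hb0.le (one_le_pow₀ hr.le))
        fun s hs => ?_
      have : 0 < s := hb0.trans_le hs.1
      positivity
    have h5 : (e (0 + 1) ^ p - e 0 ^ p) / (1 + e (0 + 1)) = 0 := by simp [e]
    rw [h5, add_zero]
    have h6 : 1 ≤ (1 + a) * p := by rwa [div_le_iff₀ hp] at ha1
    calc 1 / r * ∫ s in b..(b * r ^ J), s ^ (p - 1) / (s + 1)
        ≤ ((1 + a) * p) / r * ∫ s in b..(b * r ^ J), s ^ (p - 1) / (s + 1) := by gcongr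
      _ = (1 + a) * (p / r * ∫ s in b..(b * r ^ J), s ^ (p - 1) / (s + 1)) := by ring
      _ ≤ _ := mul_le_mul_of_nonneg_left h1 (by nlinarith)

theorem ExistsExtremalMartingale.mono {p c d : ℝ} (h : ExistsExtremalMartingale p d)
    (hcd : c ≤ d) : ExistsExtremalMartingale p c := by
  obtain ⟨Ω, m0, P, hP, hPc, ℱ, X, hX, hXc, hX0, hpos, hbdd, hlt⟩ := h
  exact ⟨Ω, m0, P, hP, hPc, ℱ, X, hX, hXc, hX0, hpos, hbdd,
    (mul_le_mul_of_nonneg_right hcd hpos.le).trans_lt hlt⟩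

end Construction

/-- Sharpness of the constant `𝔠_p` in `sup_t ‖M_t‖_p ≤ 𝔠_p · sup_t ‖M⁻_t‖_p`, where
`𝔠_p^p = (1/p − 1)^p + ∫_{1/p−1}^∞ s^(p−1)/(s+1) ds` for `p ≤ 1/2` and
`𝔠_p^p = 1 + ∫_1^∞ s^(p−1)/(s+1) ds` for `p > 1/2`: for each `0 < p < 1` and each
`c < 𝔠_p` there is a continuous martingale starting from `0` with
`0 < sup_t ‖M⁻_t‖_p < ∞` and `sup_t ‖M_t‖_p > c · sup_t ‖M⁻_t‖_p`. -/
theorem sharpness_frak_cp (p : ℝ) (hp : 0 < p) (hp1 : p < 1)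
    (fcp : ℝ)
    (hfcp₁ : p ≤ 1 / 2 →
      fcp = ((1 / p - 1) ^ p
        + ∫ s in Set.Ioi (1 / p - 1), s ^ (p - 1) / (s + 1)) ^ (1 / p))
    (hfcp₂ : 1 / 2 < p →
      fcp = (1 + ∫ s in Set.Ioi (1 : ℝ), s ^ (p - 1) / (s + 1)) ^ (1 / p))
    (c : ℝ) (hc : c < fcp) :
    ∃ (Ω : Type) (m0 : MeasurableSpace Ω) (P : Measure Ω),
      IsProbabilityMeasure P ∧ P.IsComplete ∧
      ∃ (ℱ : Filtration ℝ≥0 m0) (X : ℝ≥0 → Ω → ℝ),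
        Martingale X ℱ P ∧
        (∀ ω, Continuous fun t => X t ω) ∧
        (∀ᵐ ω ∂P, X 0 ω = 0) ∧
        (0 < ⨆ t : ℝ≥0,
          (∫ ω, (-(⨅ s : Set.Icc (0 : ℝ≥0) t, min (X s.1 ω) 0)) ^ p ∂P) ^ (1 / p)) ∧
        BddAbove (Set.range fun t : ℝ≥0 =>
          (∫ ω, (-(⨅ s : Set.Icc (0 : ℝ≥0) t, min (X s.1 ω) 0)) ^ p ∂P) ^ (1 / p)) ∧
        (⨆ t : ℝ≥0,
            (∫ ω, (⨆ s : Set.Icc (0 : ℝ≥0) t, |X s.1 ω|) ^ p ∂P) ^ (1 / p))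
          > c * ⨆ t : ℝ≥0,
              (∫ ω, (-(⨅ s : Set.Icc (0 : ℝ≥0) t, min (X s.1 ω) 0)) ^ p ∂P) ^ (1 / p) := by
  obtain ⟨x, hx, hf⟩ : ∃ x : ℝ, x = max 1 (1 / p - 1) ∧
      fcp = (x ^ p + ∫ s in Set.Ioi x, s ^ (p - 1) / (s + 1)) ^ (1 / p) := by
    rcases le_or_gt p (1 / 2) with h | h
    · have h1 : 2 ≤ 1 / p := by rw [le_div_iff₀ hp]; linarith
      exact ⟨1 / p - 1, (max_eq_right (by linarith)).symm, hfcp₁ h⟩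
    · have h1 : 1 / p ≤ 2 := by rw [div_le_iff₀ hp]; linarith
      exact ⟨1, (max_eq_left (by linarith)).symm, by rw [hfcp₂ h, Real.one_rpow]⟩
  have hx0 : 0 < x := one_pos.trans_le (hx ▸ le_max_left _ _)
  have hφ : 0 < x ^ p + ∫ s in Set.Ioi x, s ^ (p - 1) / (s + 1) :=
    add_pos_of_pos_of_nonneg (Real.rpow_pos_of_pos hx0 p)
      (setIntegral_nonneg measurableSet_Ioi fun s hs => by
        have : 0 < s := hx0.trans hs
        positivity)
  have hc' : max c 0 < fcp := max_lt hc (hf ▸ Real.rpow_pos_of_pos hφ _)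
  refine ExistsExtremalMartingale.mono (d := max c 0)
    (existsExtremalMartingale_of_lt hp hp1 (le_max_right c 0) hx ?_) (le_max_left c 0)
  have h1 := Real.rpow_lt_rpow (le_max_right c 0) hc' hp
  rwa [hf, ← Real.rpow_mul hφ.le, one_div_mul_cancel hp.ne', Real.rpow_one] at h1
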